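/- Let K be a convex k-gon and let T be a tree with at least three vertices whose spine has at most k leaves. Then T is the graph of some outer local flat folding on K. -/

import Mathlib

noncomputable section

open Set

/-- The closed half-plane bounded by the line through `p` with direction `d`,
lying on the counterclockwise side of that line. -/
def closedHalfPlane (p d : ℂ) : Set ℂ := {z : ℂ | 0 ≤ ((z - p) * starRingEnd ℂ d).im}

/-- The closed wedge with apex `p` spanned by the directions with angles in `[α, β]`. -/
def wedge (p : ℂ) (α β : ℝ) : Set ℂ :=
  {z : ℂ | ∃ r : ℝ, 0 ≤ r ∧ ∃ t : ℝ, α ≤ t ∧ t ≤ β ∧ z = p + r * Complex.exp (t * Complex.I)}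

/-- Euclidean three-dimensional space. -/
abbrev Space3 := EuclideanSpace ℝ (Fin 3)

/-- Vertical projection from three-dimensional space to the plane. -/
def proj2 (q : Space3) : ℂ := ⟨q 0, q 1⟩


/-- `p` is an *unfolded point* of the folding `φ` of the sheet `K`: `φ` agrees with a Euclidean
isometry on the intersection of `K` with some neighborhood of `p`. -/
def UnfoldedPtOn (K : Set ℂ) (φ : ℂ → ℂ) (p : ℂ) : Prop :=
  ∃ U ∈ nhds p, ∃ f : ℂ ≃ᵢ ℂ, Set.EqOn φ ⇑f (U ∩ K)

/-- `p` is a *crease point* of the folding `φ` of the sheet `K`: near `p`, the sheet is covered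
by the two closed half-planes bounded by a line through `p`, with `φ` agreeing with two
distinct isometries on the two halves. -/
def CreasePtOn (K : Set ℂ) (φ : ℂ → ℂ) (p : ℂ) : Prop :=
  ∃ U ∈ nhds p, ∃ d : ℂ, d ≠ 0 ∧ ∃ f₁ f₂ : ℂ ≃ᵢ ℂ, f₁ ≠ f₂ ∧
    Set.EqOn φ ⇑f₁ (U ∩ K ∩ closedHalfPlane p d) ∧
    Set.EqOn φ ⇑f₂ (U ∩ K ∩ closedHalfPlane p (-d))

/-- `p` is a *vertex point* of the folding `φ` of the sheet `K`: near `p`, the sheet is covered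
by finitely many (at least three) closed wedges with apex `p`, with `φ` agreeing with an
isometry on each wedge and at least three distinct isometries occurring. -/
def VertexPtOn (K : Set ℂ) (φ : ℂ → ℂ) (p : ℂ) : Prop :=
  ∃ U ∈ nhds p, ∃ n : ℕ, 3 ≤ n ∧ ∃ (α β : Fin n → ℝ) (f : Fin n → ℂ ≃ᵢ ℂ),
    (∀ i, α i < β i) ∧ (U ∩ K) ⊆ ⋃ i, wedge p (α i) (β i) ∧
    (∀ i, Set.EqOn φ ⇑(f i) (U ∩ K ∩ wedge p (α i) (β i))) ∧
    3 ≤ (Set.range f).ncard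

/-- An *outer local flat folding* of a compact convex region `K`: every point of `K` is an
unfolded point, a crease point, or a vertex point, and all vertex points lie on the boundary
of `K`. -/
structure IsOuterLocalFlatFolding (K : Set ℂ) (φ : ℂ → ℂ) : Prop where
  compact : IsCompact K
  convex : Convex ℝ K
  interior_nonempty : (interior K).Nonempty
  continuousOn : ContinuousOn φ K
  classify : ∀ p ∈ K, UnfoldedPtOn K φ p ∨ CreasePtOn K φ p ∨ VertexPtOn K φ p
  vertex_boundary : ∀ p ∈ K, VertexPtOn K φ p → p ∈ frontier K

/-- The creases of an outer folding are chords of `K`: `u` and `v` are boundary points, the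
open segment between them passes through the interior of `K`, and consists of crease points. -/
def IsCreaseOf (K : Set ℂ) (φ : ℂ → ℂ) (u v : ℂ) : Prop :=
  u ∈ frontier K ∧ v ∈ frontier K ∧ u ≠ v ∧
  openSegment ℝ u v ⊆ interior K ∧
  ∀ z ∈ openSegment ℝ u v, CreasePtOn K φ z

/-- An *outer global flat folding*: an outer local flat folding that, for every `ε > 0`, is
`ε`-close to the vertical projection of a topological embedding of `K` into space. -/
def IsOuterGlobalFlatFolding (K : Set ℂ) (φ : ℂ → ℂ) : Prop :=
  IsOuterLocalFlatFolding K φ ∧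
  ∀ ε : ℝ, 0 < ε → ∃ ψ : ℂ → Space3,
    Topology.IsEmbedding (fun p : K => ψ ↑p) ∧ ∀ p ∈ K, dist (φ p) (proj2 (ψ p)) ≤ ε

/-- `C` is one of the two regions into which the segment `uv` divides `K`. -/
def SideRegion (K : Set ℂ) (u v : ℂ) (C : Set ℂ) : Prop :=
  C = K ∩ {z : ℂ | 0 ≤ ((z - u) * starRingEnd ℂ (v - u)).im} ∨
  C = K ∩ {z : ℂ | ((z - u) * starRingEnd ℂ (v - u)).im ≤ 0}

/-- Along the boundary curve of `C` from `u` to `v` (the part of the boundary of `K` on `C`'s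
side), distances from `u` are monotonically increasing and distances from `v` are
monotonically decreasing. -/
def MonotoneBoundaryArc (K : Set ℂ) (u v : ℂ) (C : Set ℂ) : Prop :=
  ∃ γ : ℝ → ℂ, ContinuousOn γ (Set.Icc 0 1) ∧ γ 0 = u ∧ γ 1 = v ∧
    γ '' Set.Icc 0 1 = frontier K ∩ C ∧
    MonotoneOn (fun t => dist u (γ t)) (Set.Icc 0 1) ∧
    AntitoneOn (fun t => dist v (γ t)) (Set.Icc 0 1)

/-- Reflection of the plane across the line through `u` and `v`. -/
def lineReflect (u v z : ℂ) : ℂ := u + (v - u) * starRingEnd ℂ ((z - u) / (v - u))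

/-- A crease `uv` of `φ`, splitting off the region `C` of `K` with monotone boundary arc, is
*safe* when the reflection across the line `uv` of the boundary arc of `C` does not cross any
crease of `φ`. -/
def SafeCrease (K : Set ℂ) (φ : ℂ → ℂ) (u v : ℂ) (C : Set ℂ) : Prop :=
  IsCreaseOf K φ u v ∧ SideRegion K u v C ∧ MonotoneBoundaryArc K u v C ∧
  ∀ p ∈ lineReflect u v '' (frontier K ∩ C), p ∉ segment ℝ u v → ¬ CreasePtOn K φ p

/-- The vertices of the graph of an outer folding: boundary points of `K` lying on creases. -/
def OuterVertex (K : Set ℂ) (φ : ℂ → ℂ) : Type := {p : ℂ // ∃ q : ℂ, IsCreaseOf K φ p q}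

/-- The graph of an outer folding: vertices are boundary points of `K` on creases, and edges
join the two endpoints of each crease. -/
def outerGraph (K : Set ℂ) (φ : ℂ → ℂ) : SimpleGraph (OuterVertex K φ) :=
  SimpleGraph.fromRel fun a b => IsCreaseOf K φ a.1 b.1

/-- `K` is a (closed, solid) square in the plane. -/
def IsSquareRegion (K : Set ℂ) : Prop :=
  ∃ c w : ℂ, w ≠ 0 ∧
    K = (fun z : ℂ => c + w * z) '' {z : ℂ | z.re ∈ Set.Icc 0 1 ∧ z.im ∈ Set.Icc 0 1}


/-- `K` is a convex polygon with `k` vertices (in strictly convex position). -/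
def IsConvexPolygon (K : Set ℂ) (k : ℕ) : Prop :=
  3 ≤ k ∧ ∃ P : Fin k → ℂ, K = convexHull ℝ (Set.range P) ∧
    ∀ i : Fin k, P i ∉ convexHull ℝ (P '' {j : Fin k | j ≠ i})

/-- The leaves of the spine of a tree `T`: the spine consists of the non-leaf vertices of `T`
(vertices of degree different from one), and its leaves are the spine vertices having exactly
one neighbor in the spine. -/
def spineLeaves {V : Type} (T : SimpleGraph V) : Set V :=
  {v : V | (T.neighborSet v).ncard ≠ 1 ∧
    (T.neighborSet v ∩ {w : V | (T.neighborSet w).ncard ≠ 1}).ncard = 1}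

/-- Two planar isometries that agree on a nonempty open set are equal. -/
theorem isometryEquiv_eq_of_eqOn_open {f g : ℂ ≃ᵢ ℂ} {O : Set ℂ} (hO : IsOpen O)
    (hne : O.Nonempty) (h : EqOn f g O) : f = g := by
  have key : f.toRealAffineIsometryEquiv.toAffineEquiv.toAffineMap =
      g.toRealAffineIsometryEquiv.toAffineEquiv.toAffineMap := by
    refine AffineMap.ext_on (hO.affineSpan_eq_top hne) fun x hx => ?_
    simpa using h hx
  ext1 x
  simpa using congrArg (fun F : ℂ →ᵃ[ℝ] ℂ => F x) key

/-- The signed side of `z` relative to the line through `p` with direction `d`. -/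
def lineSide (p d z : ℂ) : ℝ := ((z - p) * starRingEnd ℂ d).im

theorem lineSide_eq (p d z : ℂ) :
    lineSide p d z = (z.im - p.im) * d.re - (z.re - p.re) * d.im := by
  simp [lineSide, Complex.mul_im]
  ring

theorem continuous_lineSide (p d : ℂ) : Continuous (lineSide p d) := by
  unfold lineSide
  fun_prop

theorem lineSide_neg (p d z : ℂ) : lineSide p (-d) z = -lineSide p d z := by
  simp [lineSide]

theorem mem_closedHalfPlane {p d z : ℂ} : z ∈ closedHalfPlane p d ↔ 0 ≤ lineSide p d z :=
  Iff.rfl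

theorem lineSide_add_real_smul (p d z w : ℂ) (t : ℝ) :
    lineSide p d (z + t * (w - z)) = lineSide p d z + t * (lineSide p d w - lineSide p d z) := by
  simp [lineSide_eq]
  ring

/-- Points on the line through `p` with direction `d` are of the form `p + t * d`. -/
theorem exists_eq_add_mul_of_lineSide_eq_zero {p d z : ℂ} (hd : d ≠ 0)
    (h : lineSide p d z = 0) : ∃ t : ℝ, z = p + t * d := by
  have hn : d.re ^ 2 + d.im ^ 2 ≠ 0 := by
    intro h0
    apply hd
    apply Complex.ext <;> simp <;> nlinarith [sq_nonneg d.re, sq_nonneg d.im]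
  rw [lineSide_eq] at h
  obtain ⟨t, ht⟩ : ∃ t : ℝ,
      t = ((z.re - p.re) * d.re + (z.im - p.im) * d.im) / (d.re ^ 2 + d.im ^ 2) := ⟨_, rfl⟩
  rw [eq_div_iff hn] at ht
  refine ⟨t, Complex.ext ?_ ?_⟩
  · simp only [Complex.add_re, Complex.re_ofReal_mul]
    refine mul_right_cancel₀ hn ?_
    linear_combination (-d.im) * h - d.re * ht
  · simp only [Complex.add_im, Complex.im_ofReal_mul]
    refine mul_right_cancel₀ hn ?_
    linear_combination (d.re) * h - d.im * ht

theorem lineSide_add_mul (p d : ℂ) (t : ℝ) : lineSide p d (p + t * d) = 0 := by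
  simp [lineSide_eq]
  ring

theorem lineSide_normal (p d : ℂ) (t : ℝ) :
    lineSide p d (p + t * (Complex.I * d)) = t * (d.re ^ 2 + d.im ^ 2) := by
  simp [lineSide_eq]
  ring

theorem sq_add_sq_pos_of_ne_zero {d : ℂ} (hd : d ≠ 0) : 0 < d.re ^ 2 + d.im ^ 2 := by
  have := Complex.normSq_pos.2 hd
  rw [Complex.normSq_apply] at this
  nlinarith

/-- Arbitrarily close to any point there are points strictly on the positive side of a line
through it. -/
theorem mem_closure_lineSide_pos {d : ℂ} (hd : d ≠ 0) {p x : ℂ} (hx : 0 ≤ lineSide p d x) :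
    x ∈ closure {z | 0 < lineSide p d z} := by
  have hc : Filter.Tendsto (fun t : ℝ => x + t * (Complex.I * d)) (nhdsWithin 0 (Ioi 0))
      (nhds x) := by
    have : Continuous (fun t : ℝ => x + t * (Complex.I * d)) := by fun_prop
    simpa using (this.tendsto 0).mono_left nhdsWithin_le_nhds
  refine mem_closure_of_tendsto hc (eventually_nhdsWithin_of_forall fun t ht => ?_)
  have hpos := mul_pos (mem_Ioi.1 ht) (sq_add_sq_pos_of_ne_zero hd)
  have : lineSide p d (x + t * (Complex.I * d)) =
      lineSide p d x + t * (d.re ^ 2 + d.im ^ 2) := by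
    simp [lineSide_eq]
    ring
  rw [mem_ofPred_eq, this]
  linarith

/-- A nonempty open set meets the complement of any line. -/
theorem exists_lineSide_ne_zero {O : Set ℂ} (hO : IsOpen O) (hne : O.Nonempty) (p : ℂ) {d : ℂ}
    (hd : d ≠ 0) : ∃ x ∈ O, lineSide p d x ≠ 0 := by
  obtain ⟨x, hx⟩ := hne
  by_cases h : lineSide p d x = 0
  · obtain ⟨y, hy, hyO⟩ := mem_closure_iff.1 (mem_closure_lineSide_pos hd h.ge) O hO hx
    exact ⟨y, hy, ne_of_gt hyO⟩
  · exact ⟨x, hx, h⟩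

/-- Every wedge contains an open set accumulating at its apex. -/
theorem exists_isOpen_subset_wedge (p : ℂ) {α β : ℝ} (h : α < β) :
    ∃ O : Set ℂ, IsOpen O ∧ O ⊆ wedge p α β ∧ p ∈ closure O := by
  refine ⟨(fun z => p + z) '' (Complex.exp '' {z : ℂ | α < z.im ∧ z.im < β}), ?_, ?_, ?_⟩
  · refine (Homeomorph.addLeft p).isOpenMap _ (Complex.isOpenMap_exp _ ?_)
    exact (isOpen_lt continuous_const Complex.continuous_im).inter
      (isOpen_lt Complex.continuous_im continuous_const)
  · rintro _ ⟨_, ⟨z, ⟨h1, h2⟩, rfl⟩, rfl⟩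
    refine ⟨Real.exp z.re, (Real.exp_pos _).le, z.im, h1.le, h2.le, ?_⟩
    simp only [Complex.ofReal_exp]
    rw [← Complex.exp_add, Complex.re_add_im]
  · have hc : Filter.Tendsto (fun s : ℝ => p + Complex.exp (s + ((α + β) / 2 : ℝ) * Complex.I))
        Filter.atBot (nhds p) := by
      have h0 : Filter.Tendsto (fun s : ℝ => Complex.exp (s + ((α + β) / 2 : ℝ) * Complex.I))
          Filter.atBot (nhds 0) := by
        rw [tendsto_zero_iff_norm_tendsto_zero]
        simp only [Complex.norm_exp]
        simpa using Real.tendsto_exp_atBot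
      simpa using h0.const_add p
    refine mem_closure_of_tendsto hc (Filter.Eventually.of_forall fun s => ?_)
    refine ⟨_, ⟨_, ⟨?_, ?_⟩, rfl⟩, rfl⟩ <;> simp <;> linarith

/-- An interior point near which a folding is given by at most two isometries on the sides of
a line is not a vertex point. -/
theorem not_vertexPtOn_of_eqOn_halfPlanes {K : Set ℂ} {φ : ℂ → ℂ} {p d : ℂ}
    (hp : p ∈ interior K) {U : Set ℂ} (hU : U ∈ nhds p) (hd : d ≠ 0) {f₁ f₂ : ℂ ≃ᵢ ℂ}
    (h₁ : EqOn φ f₁ (U ∩ K ∩ closedHalfPlane p d))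
    (h₂ : EqOn φ f₂ (U ∩ K ∩ closedHalfPlane p (-d))) : ¬ VertexPtOn K φ p := by
  rintro ⟨W, hW, n, -, α, β, f, hαβ, -, hf, hcard⟩
  have hN : interior (U ∩ W ∩ K) ∈ nhds p := interior_mem_nhds.2
    (Filter.inter_mem (Filter.inter_mem hU hW) (mem_interior_iff_mem_nhds.1 hp))
  have hsub : range f ⊆ {f₁, f₂} := by
    rintro _ ⟨i, rfl⟩
    obtain ⟨O, hO, hOw, hpO⟩ := exists_isOpen_subset_wedge p (hαβ i)
    have hne : (interior (U ∩ W ∩ K) ∩ O).Nonempty :=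
      mem_closure_iff_nhds.1 hpO _ hN
    have hopen : IsOpen (interior (U ∩ W ∩ K) ∩ O) := isOpen_interior.inter hO
    obtain ⟨x, hx, hxs⟩ := exists_lineSide_ne_zero hopen hne p hd
    rcases lt_or_gt_of_ne hxs with hlt | hgt
    · right
      refine isometryEquiv_eq_of_eqOn_open
        (hopen.inter (isOpen_lt (continuous_lineSide p d) continuous_const)) ⟨x, hx, hlt⟩ ?_
      rintro y ⟨⟨hy, hyO⟩, hys⟩
      obtain ⟨⟨hyU, hyW⟩, hyK⟩ := interior_subset hy
      rw [← hf i ⟨⟨hyW, hyK⟩, hOw hyO⟩, h₂ ⟨⟨hyU, hyK⟩, ?_⟩]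
      rw [mem_closedHalfPlane, lineSide_neg]
      exact (neg_pos.2 hys).le
    · left
      refine isometryEquiv_eq_of_eqOn_open
        (hopen.inter (isOpen_lt continuous_const (continuous_lineSide p d))) ⟨x, hx, hgt⟩ ?_
      rintro y ⟨⟨hy, hyO⟩, hys⟩
      obtain ⟨⟨hyU, hyW⟩, hyK⟩ := interior_subset hy
      rw [← hf i ⟨⟨hyW, hyK⟩, hOw hyO⟩, h₁ ⟨⟨hyU, hyK⟩, mem_closedHalfPlane.2 (le_of_lt hys)⟩]
  have h1 := ncard_le_ncard hsub (by simp)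
  have h2 := ncard_insert_le f₁ {f₂}
  rw [ncard_singleton] at h2
  omega

theorem UnfoldedPtOn.not_vertexPtOn {K : Set ℂ} {φ : ℂ → ℂ} {p : ℂ} (hp : p ∈ interior K)
    (h : UnfoldedPtOn K φ p) : ¬ VertexPtOn K φ p := by
  obtain ⟨U, hU, f, hf⟩ := h
  exact not_vertexPtOn_of_eqOn_halfPlanes hp hU one_ne_zero (hf.mono inter_subset_left)
    (hf.mono inter_subset_left)

theorem CreasePtOn.not_vertexPtOn {K : Set ℂ} {φ : ℂ → ℂ} {p : ℂ} (hp : p ∈ interior K)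
    (h : CreasePtOn K φ p) : ¬ VertexPtOn K φ p := by
  obtain ⟨U, hU, d, hd, f₁, f₂, -, h₁, h₂⟩ := h
  exact not_vertexPtOn_of_eqOn_halfPlanes hp hU hd h₁ h₂

theorem UnfoldedPtOn.not_creasePtOn {K : Set ℂ} {φ : ℂ → ℂ} {p : ℂ} (hp : p ∈ interior K)
    (h : UnfoldedPtOn K φ p) : ¬ CreasePtOn K φ p := by
  obtain ⟨U, hU, f, hf⟩ := h
  rintro ⟨W, hW, d, hd, f₁, f₂, hne, h₁, h₂⟩
  have hN : interior (U ∩ W ∩ K) ∈ nhds p := interior_mem_nhds.2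
    (Filter.inter_mem (Filter.inter_mem hU hW) (mem_interior_iff_mem_nhds.1 hp))
  have key : ∀ (e : ℂ) (g : ℂ ≃ᵢ ℂ), e ≠ 0 → EqOn φ g (W ∩ K ∩ closedHalfPlane p e) → g = f := by
    intro e g he hg
    have hcl : p ∈ closure {z | 0 < lineSide p e z} :=
      mem_closure_lineSide_pos he (by simp [lineSide])
    refine isometryEquiv_eq_of_eqOn_open (isOpen_interior.inter
      (isOpen_lt continuous_const (continuous_lineSide p e)))
      (mem_closure_iff_nhds.1 hcl _ hN) ?_
    rintro y ⟨hy, hys⟩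
    obtain ⟨⟨hyU, hyW⟩, hyK⟩ := interior_subset hy
    rw [← hf ⟨hyU, hyK⟩, hg ⟨⟨hyW, hyK⟩, mem_closedHalfPlane.2 (le_of_lt hys)⟩]
  exact hne ((key d f₁ hd h₁).trans (key (-d) f₂ (neg_ne_zero.2 hd) h₂).symm)

/-- If every point of a preconnected subset of the interior is unfolded, then a single isometry
describes the folding near all of its points. -/
theorem exists_isometryEquiv_of_isPreconnected {K : Set ℂ} {φ : ℂ → ℂ} {C : Set ℂ}
    (hC : IsPreconnected C) (hne : C.Nonempty) (hCK : C ⊆ interior K)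
    (h : ∀ p ∈ C, UnfoldedPtOn K φ p) : ∃ f : ℂ ≃ᵢ ℂ, ∀ p ∈ C, φ =ᶠ[nhds p] f := by
  have hloc : ∀ p ∈ C, ∃ f : ℂ ≃ᵢ ℂ, φ =ᶠ[nhds p] f := by
    intro p hp
    obtain ⟨U, hU, f, hf⟩ := h p hp
    exact ⟨f, Filter.eventuallyEq_of_mem
      (Filter.inter_mem hU (mem_interior_iff_mem_nhds.1 (hCK hp))) hf⟩
  obtain ⟨x, hx⟩ := hne
  obtain ⟨f, hf⟩ := hloc x hx
  refine ⟨f, fun p hp => ?_⟩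
  by_contra hcon
  have hopen : ∀ g : ℂ ≃ᵢ ℂ, IsOpen {y | φ =ᶠ[nhds y] g} := fun g => isOpen_setOfPred_eventually_nhds
  have hopen' : IsOpen (⋃ g ∈ {g : ℂ ≃ᵢ ℂ | g ≠ f}, {y | φ =ᶠ[nhds y] g}) :=
    isOpen_biUnion fun g _ => hopen g
  obtain ⟨g, hg⟩ := hloc p hp
  have hgf : g ≠ f := fun hgf => hcon (hgf ▸ hg)
  obtain ⟨y, -, hy1, hy2⟩ := hC _ _ (hopen f) hopen' (fun y hy => by
    obtain ⟨g', hg'⟩ := hloc y hy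
    by_cases hgf' : g' = f
    · left; subst hgf'; exact hg'
    · right; exact mem_biUnion hgf' hg') ⟨x, hx, hf⟩ ⟨p, hp, mem_biUnion hgf hg⟩
  obtain ⟨g', hg', hyg'⟩ := mem_iUnion₂.1 hy2
  have hev : ∀ᶠ z in nhds y, f z = g' z := by
    filter_upwards [hy1, hyg'] with z h1 h2 using h1.symm.trans h2
  obtain ⟨O, hO, hOo, hyO⟩ := eventually_nhds_iff.1 hev
  exact hg' (isometryEquiv_eq_of_eqOn_open hOo ⟨y, hyO⟩ fun z hz => (hO z hz).symm)

/-- There is a nontrivial isometry fixing a given line pointwise. -/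
theorem exists_isometryEquiv_fixing_line (p : ℂ) {d : ℂ} (hd : d ≠ 0) :
    ∃ R : ℂ ≃ᵢ ℂ, R ≠ IsometryEquiv.refl ℂ ∧ ∀ z, lineSide p d z = 0 → R z = z := by
  refine ⟨(EuclideanGeometry.reflection (AffineSubspace.mk' p (Submodule.span ℝ {d}))).toIsometryEquiv,
    fun hR => ?_, fun z hz => ?_⟩
  · have h1 : p + Complex.I * d ∈ AffineSubspace.mk' p (Submodule.span ℝ {d}) := by
      rw [← EuclideanGeometry.reflection_eq_self_iff]
      exact congrArg (fun F : ℂ ≃ᵢ ℂ => F (p + Complex.I * d)) hR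
    rw [AffineSubspace.mem_mk', Submodule.mem_span_singleton] at h1
    obtain ⟨t, ht⟩ := h1
    have h2 := lineSide_normal p d 1
    have h3 := lineSide_add_mul p d t
    have h4 : p + (t : ℂ) * d = p + ((1 : ℝ) : ℂ) * (Complex.I * d) := by
      simpa using ht
    rw [h4, h2] at h3
    have := sq_add_sq_pos_of_ne_zero hd
    linarith
  · obtain ⟨t, rfl⟩ := exists_eq_add_mul_of_lineSide_eq_zero hd hz
    have : p + t * d ∈ AffineSubspace.mk' p (Submodule.span ℝ {d}) := by
      rw [AffineSubspace.mem_mk', Submodule.mem_span_singleton]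
      exact ⟨t, by simp⟩
    simpa using (EuclideanGeometry.reflection_eq_self_iff _).2 this

/-- `uv` is a chord of `K`: its endpoints are boundary points and its relative interior lies in
the interior of `K`. -/
structure IsChord (K : Set ℂ) (u v : ℂ) : Prop where
  left_mem : u ∈ frontier K
  right_mem : v ∈ frontier K
  ne : u ≠ v
  subset_interior : openSegment ℝ u v ⊆ interior K

theorem IsChord.symm {K : Set ℂ} {u v : ℂ} (h : IsChord K u v) : IsChord K v u :=
  ⟨h.right_mem, h.left_mem, h.ne.symm, openSegment_symm ℝ u v ▸ h.subset_interior⟩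

theorem openSegment_nonempty' (u v : ℂ) : (openSegment ℝ u v).Nonempty :=
  ⟨_, midpoint_mem_openSegment u v⟩

theorem mem_segment_iff_exists_ofReal {u v z : ℂ} :
    z ∈ segment ℝ u v ↔ ∃ t : ℝ, 0 ≤ t ∧ t ≤ 1 ∧ z = u + t * (v - u) := by
  rw [segment_eq_image']
  simp [and_assoc, eq_comm]

theorem mem_openSegment_iff_exists_ofReal {u v z : ℂ} :
    z ∈ openSegment ℝ u v ↔ ∃ t : ℝ, 0 < t ∧ t < 1 ∧ z = u + t * (v - u) := by
  rw [openSegment_eq_image']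
  simp [and_assoc, eq_comm]

/-- If `b` lies strictly between an interior point and a point of `K`, it is interior. -/
theorem not_mem_frontier_of_between {K : Set ℂ} (hK : Convex ℝ K) {a b c : ℂ}
    (ha : a ∈ interior K) (hc : c ∈ K) (hb : b ∈ openSegment ℝ a c) : b ∉ frontier K :=
  fun h => h.2 (hK.openSegment_interior_self_subset_interior ha hc hb)

/-- The line through a chord meets `K` only along the chord. -/
theorem IsChord.mem_segment {K : Set ℂ} (hK : Convex ℝ K) {u v z : ℂ} (h : IsChord K u v)
    (hz : z ∈ K) (hs : lineSide u (v - u) z = 0) : z ∈ segment ℝ u v := by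
  obtain ⟨t, rfl⟩ := exists_eq_add_mul_of_lineSide_eq_zero (sub_ne_zero.2 h.ne.symm) hs
  have hm : u + (1 / 2 : ℝ) * (v - u) ∈ interior K :=
    h.subset_interior (mem_openSegment_iff_exists_ofReal.2 ⟨1 / 2, by norm_num, by norm_num, rfl⟩)
  rw [mem_segment_iff_exists_ofReal]
  by_contra hcon
  push Not at hcon
  rcases lt_or_ge t 0 with h0 | h0
  · refine not_mem_frontier_of_between hK hm hz ?_ h.left_mem
    have ht : (1 / 2 : ℝ) - t > 0 := by linarith
    obtain ⟨l, hl⟩ : ∃ l : ℝ, l = (1 / 2) / (1 / 2 - t) := ⟨_, rfl⟩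
    refine mem_openSegment_iff_exists_ofReal.2 ⟨l, by rw [hl]; positivity,
      by rw [hl, div_lt_one ht]; linarith, ?_⟩
    rw [eq_div_iff ht.ne'] at hl
    have hl' : (l : ℂ) * (1 / 2 - t) = 1 / 2 := by simpa using congrArg Complex.ofReal hl
    push_cast
    linear_combination (v - u) * hl'
  · rcases lt_or_ge 1 t with h1 | h1
    · refine not_mem_frontier_of_between hK hm hz ?_ h.right_mem
      have ht : t - (1 / 2 : ℝ) > 0 := by linarith
      obtain ⟨l, hl⟩ : ∃ l : ℝ, l = (1 / 2) / (t - 1 / 2) := ⟨_, rfl⟩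
      refine mem_openSegment_iff_exists_ofReal.2 ⟨l, by rw [hl]; positivity,
        by rw [hl, div_lt_one ht]; linarith, ?_⟩
      rw [eq_div_iff ht.ne'] at hl
      have hl' : (l : ℂ) * (t - 1 / 2) = 1 / 2 := by
        simpa using congrArg Complex.ofReal hl
      push_cast
      linear_combination -(v - u) * hl'
    · exact hcon t h0 h1 rfl

theorem IsChord.mem_openSegment {K : Set ℂ} (hK : Convex ℝ K) {u v z : ℂ} (h : IsChord K u v)
    (hz : z ∈ interior K) (hs : lineSide u (v - u) z = 0) : z ∈ openSegment ℝ u v := by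
  refine mem_openSegment_of_ne_left_right ?_ ?_ (h.mem_segment hK (interior_subset hz) hs)
  · rintro rfl
    exact h.left_mem.2 hz
  · rintro rfl
    exact h.right_mem.2 hz

theorem lineSide_eq_zero_of_mem_segment {u v z : ℂ} (h : z ∈ segment ℝ u v) :
    lineSide u (v - u) z = 0 := by
  obtain ⟨t, -, -, rfl⟩ := mem_segment_iff_exists_ofReal.1 h
  exact lineSide_add_mul _ _ _

/-- Near `p`, the sheet `K` is covered by finitely many wedges of angle at most `π` with apex
`p`, on each of which `φ` is an isometry. -/
def IsWedgeCovered (K : Set ℂ) (φ : ℂ → ℂ) (p : ℂ) : Prop :=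
  ∃ U ∈ nhds p, ∃ F : Set (ℝ × ℝ), F.Finite ∧
    (∀ w ∈ F, w.1 < w.2 ∧ w.2 ≤ w.1 + Real.pi) ∧
    (U ∩ K ⊆ ⋃ w ∈ F, wedge p w.1 w.2) ∧
    ∀ w ∈ F, ∃ f : ℂ ≃ᵢ ℂ, EqOn φ f (U ∩ K ∩ wedge p w.1 w.2)

section Transfer

variable {K U : Set ℂ} {φ φ' : ℂ → ℂ} {p : ℂ} {ρ : ℂ ≃ᵢ ℂ}

theorem UnfoldedPtOn.of_eqOn_comp (hU : U ∈ nhds p) (h : EqOn φ' (ρ ∘ φ) (U ∩ K))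
    (hφ : UnfoldedPtOn K φ p) : UnfoldedPtOn K φ' p := by
  obtain ⟨W, hW, f, hf⟩ := hφ
  refine ⟨U ∩ W, Filter.inter_mem hU hW, f.trans ρ, fun z hz => ?_⟩
  rw [h ⟨hz.1.1, hz.2⟩, Function.comp, hf ⟨hz.1.2, hz.2⟩]
  rfl

theorem CreasePtOn.of_eqOn_comp (hU : U ∈ nhds p) (h : EqOn φ' (ρ ∘ φ) (U ∩ K))
    (hφ : CreasePtOn K φ p) : CreasePtOn K φ' p := by
  obtain ⟨W, hW, d, hd, f₁, f₂, hne, h₁, h₂⟩ := hφ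
  refine ⟨U ∩ W, Filter.inter_mem hU hW, d, hd, f₁.trans ρ, f₂.trans ρ, fun he => hne ?_,
    fun z hz => ?_, fun z hz => ?_⟩
  · ext1 z
    exact ρ.injective (congrArg (fun F : ℂ ≃ᵢ ℂ => F z) he)
  · rw [h ⟨hz.1.1.1, hz.1.2⟩, Function.comp, h₁ ⟨⟨hz.1.1.2, hz.1.2⟩, hz.2⟩]
    rfl
  · rw [h ⟨hz.1.1.1, hz.1.2⟩, Function.comp, h₂ ⟨⟨hz.1.1.2, hz.1.2⟩, hz.2⟩]
    rfl

theorem IsWedgeCovered.of_eqOn_comp (hU : U ∈ nhds p) (h : EqOn φ' (ρ ∘ φ) (U ∩ K))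
    (hφ : IsWedgeCovered K φ p) : IsWedgeCovered K φ' p := by
  obtain ⟨W, hW, F, hF, hFw, hcov, hf⟩ := hφ
  refine ⟨U ∩ W, Filter.inter_mem hU hW, F, hF, hFw, fun z hz => hcov ⟨hz.1.2, hz.2⟩,
    fun w hw => ?_⟩
  obtain ⟨f, hf⟩ := hf w hw
  refine ⟨f.trans ρ, fun z hz => ?_⟩
  rw [h ⟨hz.1.1.1, hz.1.2⟩, Function.comp, hf ⟨⟨hz.1.1.2, hz.1.2⟩, hz.2⟩]
  rfl

end Transfer

theorem lineSide_wedge (p d : ℂ) (r t : ℝ) :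
    lineSide p d (p + r * Complex.exp (t * Complex.I)) =
      r * ‖d‖ * Real.sin (t - Complex.arg d) := by
  have hre : d.re = ‖d‖ * Real.cos d.arg := (Complex.norm_mul_cos_arg d).symm
  have him : d.im = ‖d‖ * Real.sin d.arg := (Complex.norm_mul_sin_arg d).symm
  rw [lineSide_eq, Real.sin_sub, Complex.add_im, Complex.add_re, Complex.im_ofReal_mul,
    Complex.re_ofReal_mul, Complex.exp_ofReal_mul_I_re, Complex.exp_ofReal_mul_I_im, hre, him]
  ring_nf

theorem wedge_mono (p : ℂ) {α β α' β' : ℝ} (h₁ : α ≤ α') (h₂ : β' ≤ β) :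
    wedge p α' β' ⊆ wedge p α β := by
  rintro z ⟨r, hr, t, ht, ht', rfl⟩
  exact ⟨r, hr, t, h₁.trans ht, ht'.trans h₂, rfl⟩

/-- If `sin (t - δ)` has constant sign on `[α, β]`, the wedge lies on one side of the line with
direction of argument `δ`. -/
theorem wedge_subset_side {p d : ℂ} {α β : ℝ}
    (h : (∀ t ∈ Icc α β, 0 ≤ Real.sin (t - d.arg)) ∨ ∀ t ∈ Icc α β, Real.sin (t - d.arg) ≤ 0) :
    (wedge p α β ⊆ {z | 0 ≤ lineSide p d z}) ∨ wedge p α β ⊆ {z | lineSide p d z ≤ 0} := by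
  refine h.imp (fun h => ?_) fun h => ?_
  · rintro z ⟨r, hr, t, ht, ht', rfl⟩
    rw [mem_ofPred_eq, lineSide_wedge]
    exact mul_nonneg (by positivity) (h t ⟨ht, ht'⟩)
  · rintro z ⟨r, hr, t, ht, ht', rfl⟩
    rw [mem_ofPred_eq, lineSide_wedge]
    exact mul_nonpos_of_nonneg_of_nonpos (by positivity) (h t ⟨ht, ht'⟩)

/-- A wedge of angle at most `π` splits along a line through its apex into finitely many wedges
each lying on one side of the line. -/
theorem exists_wedge_split (p d : ℂ) {α β : ℝ} (h : α < β) (hπ : β ≤ α + Real.pi) :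
    ∃ F : Set (ℝ × ℝ), F.Finite ∧ (∀ w ∈ F, w.1 < w.2 ∧ w.2 ≤ w.1 + Real.pi) ∧
      (wedge p α β ⊆ ⋃ w ∈ F, wedge p w.1 w.2) ∧
      ∀ w ∈ F, wedge p w.1 w.2 ⊆ wedge p α β ∧
        ((wedge p w.1 w.2 ⊆ {z | 0 ≤ lineSide p d z}) ∨
          wedge p w.1 w.2 ⊆ {z | lineSide p d z ≤ 0}) := by
  by_cases hm : ∃ m ∈ Ioo α β, Real.sin (m - d.arg) = 0
  · obtain ⟨m, ⟨hm1, hm2⟩, hm0⟩ := hm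
    have hsin : ∀ t, Real.sin (t - d.arg) = Real.sin (t - m) * Real.cos (m - d.arg) := by
      intro t
      rw [show t - d.arg = (t - m) + (m - d.arg) by ring, Real.sin_add, hm0]
      ring
    have hhi : ∀ t ∈ Icc m β, 0 ≤ Real.sin (t - m) := fun t ht =>
      Real.sin_nonneg_of_nonneg_of_le_pi (by linarith [ht.1]) (by linarith [ht.2])
    have hlo : ∀ t ∈ Icc α m, Real.sin (t - m) ≤ 0 := fun t ht =>
      Real.sin_nonpos_of_nonpos_of_neg_pi_le (by linarith [ht.2]) (by linarith [ht.1])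
    refine ⟨{(α, m), (m, β)}, by simp, ?_, ?_, ?_⟩
    · rintro w (rfl | rfl)
      · exact ⟨hm1, by dsimp only; linarith⟩
      · exact ⟨hm2, by dsimp only; linarith⟩
    · rintro z ⟨r, hr, t, ht, ht', rfl⟩
      rw [biUnion_insert, biUnion_singleton]
      rcases le_total t m with htm | htm
      · exact Or.inl ⟨r, hr, t, ht, htm, rfl⟩
      · exact Or.inr ⟨r, hr, t, htm, ht', rfl⟩
    · rintro w (rfl | rfl)
      · refine ⟨wedge_mono p le_rfl hm2.le, wedge_subset_side ?_⟩
        rcases le_total 0 (Real.cos (m - d.arg)) with hc | hc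
        · exact Or.inr fun t ht => hsin t ▸ mul_nonpos_of_nonpos_of_nonneg (hlo t ht) hc
        · exact Or.inl fun t ht => hsin t ▸ mul_nonneg_of_nonpos_of_nonpos (hlo t ht) hc
      · refine ⟨wedge_mono p hm1.le le_rfl, wedge_subset_side ?_⟩
        rcases le_total 0 (Real.cos (m - d.arg)) with hc | hc
        · exact Or.inl fun t ht => hsin t ▸ mul_nonneg (hhi t ht) hc
        · exact Or.inr fun t ht => hsin t ▸ mul_nonpos_of_nonneg_of_nonpos (hhi t ht) hc
  · refine ⟨{(α, β)}, by simp, by simp [h, hπ], by simp, ?_⟩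
    rintro w rfl
    refine ⟨subset_rfl, wedge_subset_side ?_⟩
    by_contra hcon
    push Not at hcon
    obtain ⟨⟨a, ha, ha'⟩, b, hb, hb'⟩ := hcon
    have hcont : Continuous fun t : ℝ => Real.sin (t - d.arg) := by fun_prop
    obtain ⟨c, hc, hc0⟩ := intermediate_value_uIcc (a := a) (b := b) hcont.continuousOn
      (mem_uIcc.2 (Or.inl ⟨ha'.le, hb'.le⟩))
    have hca : c ≠ a := by rintro rfl; linarith
    have hcb : c ≠ b := by rintro rfl; linarith
    refine hm ⟨c, ?_, hc0⟩
    rcases mem_uIcc.1 hc with ⟨h1, h2⟩ | ⟨h1, h2⟩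
    · exact ⟨ha.1.trans_lt (lt_of_le_of_ne h1 hca.symm),
        (lt_of_le_of_ne h2 hcb).trans_le hb.2⟩
    · exact ⟨hb.1.trans_lt (lt_of_le_of_ne h1 hcb.symm),
        (lt_of_le_of_ne h2 hca).trans_le ha.2⟩

/-- A folding can be folded further along a chord disjoint from its creases. -/
theorem exists_fold_along_chord {K : Set ℂ} (hKc : IsClosed K) (hK : Convex ℝ K) {φ : ℂ → ℂ}
    (hφ : ContinuousOn φ K) {u v : ℂ} (hc : IsChord K u v)
    (hunf : ∀ p ∈ openSegment ℝ u v, UnfoldedPtOn K φ p) :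
    ∃ φ' : ℂ → ℂ, ContinuousOn φ' K ∧ (∀ p ∈ openSegment ℝ u v, CreasePtOn K φ' p) ∧
      (∀ p ∈ interior K, p ∉ openSegment ℝ u v →
        (UnfoldedPtOn K φ p → UnfoldedPtOn K φ' p) ∧ (CreasePtOn K φ p → CreasePtOn K φ' p)) ∧
      ∀ p ∈ frontier K, IsWedgeCovered K φ p → IsWedgeCovered K φ' p := by
  have hd : v - u ≠ 0 := sub_ne_zero.2 hc.ne.symm
  obtain ⟨f, hf⟩ := exists_isometryEquiv_of_isPreconnected
    (convex_openSegment u v).isPreconnected (openSegment_nonempty' u v) hc.subset_interior hunf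
  obtain ⟨R, hR, hRfix⟩ := exists_isometryEquiv_fixing_line u hd
  have hsegK : segment ℝ u v ⊆ K :=
    hK.segment_subset (hKc.frontier_subset hc.left_mem) (hKc.frontier_subset hc.right_mem)
  have hseg : EqOn φ f (segment ℝ u v) :=
    EqOn.of_subset_closure (s := openSegment ℝ u v) (fun z hz => (hf z hz).eq_of_nhds)
      (hφ.mono hsegK) f.continuous.continuousOn (openSegment_subset_segment ℝ u v)
      segment_subset_closure_openSegment
  set s := lineSide u (v - u) with hs
  have hscont : Continuous s := continuous_lineSide _ _
  let ρ : ℂ ≃ᵢ ℂ := f.symm.trans (R.trans f)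
  have hρf : ∀ z, ρ (f z) = f (R z) := fun z => by simp [ρ]
  let φ' : ℂ → ℂ := fun z => if 0 ≤ s z then φ z else ρ (φ z)
  have hpos : EqOn φ' φ {z | 0 ≤ s z} := fun z hz => if_pos hz
  have hneg : EqOn φ' (ρ ∘ φ) (K ∩ {z | s z ≤ 0}) := by
    rintro z ⟨hzK, hz⟩
    rcases eq_or_lt_of_le (mem_ofPred.1 hz) with h0 | h0
    · rw [hpos (mem_ofPred.2 h0.ge), Function.comp, hseg (hc.mem_segment hK hzK h0), hρf,
        hRfix z h0]
    · exact if_neg (not_le.2 h0)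
  have hoff : ∀ p, s p ≠ 0 → ∃ U ∈ nhds p, ∃ σ : ℂ ≃ᵢ ℂ, EqOn φ' (σ ∘ φ) (U ∩ K) := by
    intro p hp
    rcases lt_or_gt_of_ne hp with h0 | h0
    · refine ⟨{z | s z < 0}, (isOpen_lt hscont continuous_const).mem_nhds h0, ρ, ?_⟩
      exact fun z hz => hneg ⟨hz.2, mem_ofPred.2 (le_of_lt (mem_ofPred.1 hz.1))⟩
    · refine ⟨{z | 0 < s z}, (isOpen_lt continuous_const hscont).mem_nhds h0,
        IsometryEquiv.refl ℂ, ?_⟩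
      exact fun z hz => hpos (mem_ofPred.2 (le_of_lt (mem_ofPred.1 hz.1)))
  refine ⟨φ', ?_, ?_, ?_, ?_⟩
  · have h1 : ContinuousOn φ' (K ∩ {z | 0 ≤ s z}) :=
      (hφ.mono inter_subset_left).congr (hpos.mono inter_subset_right)
    have h2 : ContinuousOn φ' (K ∩ {z | s z ≤ 0}) :=
      (ρ.continuous.comp_continuousOn (hφ.mono inter_subset_left)).congr hneg
    have h3 := h1.union_of_isClosed h2 (hKc.inter (isClosed_le continuous_const hscont))
      (hKc.inter (isClosed_le hscont continuous_const))
    refine h3.mono fun z hz => ?_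
    rcases le_total 0 (s z) with h0 | h0
    · exact Or.inl ⟨hz, h0⟩
    · exact Or.inr ⟨hz, h0⟩
  · intro p hp
    have hp0 : s p = 0 := lineSide_eq_zero_of_mem_segment (openSegment_subset_segment ℝ u v hp)
    have hside : ∀ z, lineSide p (v - u) z = s z := by
      intro z
      have := hp0
      rw [hs, lineSide_eq] at *
      rw [lineSide_eq]
      linarith
    refine ⟨{z | φ z = f z}, hf p hp, v - u, hd, f, R.trans f, fun he => hR ?_, ?_, ?_⟩
    · ext1 z
      exact f.injective (congrArg (fun F : ℂ ≃ᵢ ℂ => F z) he).symm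
    · rintro z ⟨⟨hz, -⟩, hz'⟩
      rw [mem_closedHalfPlane, hside] at hz'
      rw [hpos hz', hz]
    · rintro z ⟨⟨hz, hzK⟩, hz'⟩
      rw [mem_closedHalfPlane, lineSide_neg, hside, neg_nonneg] at hz'
      rw [hneg ⟨hzK, hz'⟩, Function.comp, (hz : φ z = f z), hρf]
      rfl
  · intro p hp hpc
    obtain ⟨U, hU, σ, hσ⟩ := hoff p fun h0 => hpc (hc.mem_openSegment hK hp h0)
    exact ⟨fun h => h.of_eqOn_comp hU hσ, fun h => h.of_eqOn_comp hU hσ⟩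
  · intro p hp hw
    by_cases hp0 : s p = 0
    · have hside : ∀ z, lineSide p (v - u) z = s z := by
        intro z
        have := hp0
        rw [hs, lineSide_eq] at *
        rw [lineSide_eq]
        linarith
      obtain ⟨U, hU, F, hF, hFw, hcov, hFf⟩ := hw
      choose! G hGfin hGw hGcov hG using fun w (hw : w ∈ F) =>
        exists_wedge_split p (v - u) (hFw w hw).1 (hFw w hw).2
      refine ⟨U, hU, ⋃ w ∈ F, G w, hF.biUnion hGfin, ?_, ?_, ?_⟩
      · intro w hw
        obtain ⟨w', hw', hww'⟩ := mem_iUnion₂.1 hw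
        exact hGw w' hw' w hww'
      · intro z hz
        obtain ⟨w, hw, hzw⟩ := mem_iUnion₂.1 (hcov hz)
        obtain ⟨w', hw', hzw'⟩ := mem_iUnion₂.1 (hGcov w hw hzw)
        exact mem_iUnion₂.2 ⟨w', mem_iUnion₂.2 ⟨w, hw, hw'⟩, hzw'⟩
      · intro w hw
        obtain ⟨w', hw', hww'⟩ := mem_iUnion₂.1 hw
        obtain ⟨g, hg⟩ := hFf w' hw'
        obtain ⟨hsub, hor⟩ := hG w' hw' w hww'
        rcases hor with hor | hor
        · refine ⟨g, fun z hz => ?_⟩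
          rw [hpos (mem_ofPred_eq ▸ hside z ▸ hor hz.2), hg ⟨hz.1, hsub hz.2⟩]
        · refine ⟨g.trans ρ, fun z hz => ?_⟩
          rw [hneg ⟨hz.1.2, mem_ofPred_eq ▸ hside z ▸ hor hz.2⟩, Function.comp,
            hg ⟨hz.1, hsub hz.2⟩]
          rfl
    · obtain ⟨U, hU, σ, hσ⟩ := hoff p hp0
      exact hw.of_eqOn_comp hU hσ

theorem isWedgeCovered_id (K : Set ℂ) (p : ℂ) : IsWedgeCovered K id p := by
  refine ⟨univ, Filter.univ_mem, {(-Real.pi, 0), (0, Real.pi)}, by simp, ?_, ?_, ?_⟩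
  · rintro w (rfl | rfl) <;> simp [Real.pi_pos]
  · intro z _
    have hz : z = p + ‖z - p‖ * Complex.exp ((z - p).arg * Complex.I) := by
      rw [Complex.norm_mul_exp_arg_mul_I]
      ring
    rw [biUnion_insert, biUnion_singleton]
    rcases le_total (z - p).arg 0 with h | h
    · exact Or.inl ⟨_, norm_nonneg _, _, (Complex.neg_pi_lt_arg _).le, h, hz⟩
    · exact Or.inr ⟨_, norm_nonneg _, _, h, Complex.arg_le_pi _, hz⟩
  · exact fun w _ => ⟨IsometryEquiv.refl ℂ, fun z _ => rfl⟩

/-- Every finite family of pairwise noncrossing chords is the crease pattern of a folding. -/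
theorem exists_folding_of_chords {K : Set ℂ} (hKc : IsClosed K) (hK : Convex ℝ K)
    (S : Finset (ℂ × ℂ)) (hS : ∀ c ∈ S, IsChord K c.1 c.2)
    (hdisj : ∀ c ∈ S, ∀ c' ∈ S, c ≠ c' →
      Disjoint (openSegment ℝ c.1 c.2) (openSegment ℝ c'.1 c'.2)) :
    ∃ φ : ℂ → ℂ, ContinuousOn φ K ∧
      (∀ p ∈ interior K, (∀ c ∈ S, p ∉ openSegment ℝ c.1 c.2) → UnfoldedPtOn K φ p) ∧
      (∀ c ∈ S, ∀ p ∈ openSegment ℝ c.1 c.2, CreasePtOn K φ p) ∧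
      ∀ p ∈ frontier K, IsWedgeCovered K φ p := by
  classical
  induction S using Finset.induction_on with
  | empty =>
    exact ⟨id, continuousOn_id, fun p _ _ => ⟨univ, Filter.univ_mem, IsometryEquiv.refl ℂ,
      fun z _ => rfl⟩, by simp, fun p _ => isWedgeCovered_id K p⟩
  | insert c S hcS ih =>
    obtain ⟨φ, hφ, hunf, hcr, hw⟩ := ih (fun c' h => hS c' (Finset.mem_insert_of_mem h))
      fun a ha b hb => hdisj a (Finset.mem_insert_of_mem ha) b (Finset.mem_insert_of_mem hb)
    have hcS' : ∀ c' ∈ S, ∀ p ∈ openSegment ℝ c'.1 c'.2, p ∉ openSegment ℝ c.1 c.2 := by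
      intro c' hc' p hp hpc
      refine disjoint_left.1 (hdisj c (Finset.mem_insert_self c S) c'
        (Finset.mem_insert_of_mem hc') ?_) hpc hp
      rintro rfl
      exact hcS hc'
    have hc := hS c (Finset.mem_insert_self c S)
    obtain ⟨φ', hφ', hnew, hold, hw'⟩ := exists_fold_along_chord hKc hK hφ hc fun p hp =>
      hunf p (hc.subset_interior hp) fun c' hc' hp' => hcS' c' hc' p hp' hp
    refine ⟨φ', hφ', fun p hp hpS => ?_, fun c' hc' p hp => ?_, fun p hp => hw' p hp (hw p hp)⟩
    · exact (hold p hp (hpS c (Finset.mem_insert_self c S))).1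
        (hunf p hp fun c' hc' => hpS c' (Finset.mem_insert_of_mem hc'))
    · rcases Finset.mem_insert.1 hc' with rfl | hc'S
      · exact hnew p hp
      · exact (hold p ((hS c' hc').subset_interior hp) (hcS' c' hc'S p hp)).2
          (hcr c' hc'S p hp)

/-- At a boundary point of a convex set with nonempty interior there is a wedge meeting the set
only in its apex. -/
theorem exists_wedge_inter_subset {K : Set ℂ} (hK : Convex ℝ K) (hne : (interior K).Nonempty)
    {p : ℂ} (hp : p ∈ frontier K) : ∃ α β : ℝ, α < β ∧ K ∩ wedge p α β ⊆ {p} := by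
  obtain ⟨f, hf⟩ := geometric_hahn_banach_open_point hK.interior isOpen_interior hp.2
  have hle : ∀ z ∈ K, f z ≤ f p := by
    intro z hz
    have hsub : closure (interior K) ⊆ {z | f z ≤ f p} :=
      closure_minimal (fun z hz => (hf z hz).le) (isClosed_le f.continuous continuous_const)
    exact hsub ((hK.closure_interior_eq_closure_of_nonempty_interior hne).symm ▸
      subset_closure hz)
  have hfz : ∀ z : ℂ, f z = z.re * f 1 + z.im * f Complex.I := by
    intro z
    have hz : z = z.re • (1 : ℂ) + z.im • Complex.I := by simp
    conv_lhs => rw [hz, map_add, map_smul, map_smul, smul_eq_mul, smul_eq_mul]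
  set w : ℂ := ⟨f 1, f Complex.I⟩ with hw
  have hw0 : w ≠ 0 := by
    intro h0
    obtain ⟨q, hq⟩ := hne
    have h1 : f 1 = 0 := congrArg Complex.re h0
    have h2 : f Complex.I = 0 := congrArg Complex.im h0
    have := hf q hq
    rw [hfz q, hfz p, h1, h2] at this
    linarith
  have hre : f 1 = ‖w‖ * Real.cos w.arg := (Complex.norm_mul_cos_arg w).symm
  have him : f Complex.I = ‖w‖ * Real.sin w.arg := (Complex.norm_mul_sin_arg w).symm
  refine ⟨w.arg - 1, w.arg + 1, by linarith, ?_⟩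
  rintro z ⟨hzK, r, hr, t, ht, ht', rfl⟩
  have hcos : 0 < Real.cos (t - w.arg) := Real.cos_pos_of_mem_Ioo
    ⟨by linarith [Real.pi_gt_three], by linarith [Real.pi_gt_three]⟩
  have hval : f (p + r * Complex.exp (t * Complex.I)) =
      f p + r * (‖w‖ * Real.cos (t - w.arg)) := by
    rw [map_add, hfz (r * _), Complex.re_ofReal_mul, Complex.im_ofReal_mul,
      Complex.exp_ofReal_mul_I_re, Complex.exp_ofReal_mul_I_im, hre, him, Real.cos_sub]
    ring
  have hle' := hle _ hzK
  rw [hval] at hle'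
  have hpos : 0 < ‖w‖ * Real.cos (t - w.arg) := mul_pos (norm_pos_iff.2 hw0) hcos
  have hr0 : r = 0 := by
    by_contra hr0
    have := mul_pos (lt_of_le_of_ne hr (Ne.symm hr0)) hpos
    linarith
  simp [hr0]

/-- The isometry rotating about `p` by the unit complex number `ω`, composed with the
translation taking `p` to `q`. -/
def rotateTo (p q : ℂ) (ω : Circle) : ℂ ≃ᵢ ℂ :=
  ((IsometryEquiv.subRight p).trans (rotation ω).toIsometryEquiv).trans (IsometryEquiv.addRight q)

theorem rotateTo_apply (p q : ℂ) (ω : Circle) (z : ℂ) :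
    rotateTo p q ω z = ω * (z - p) + q := by
  simp [rotateTo]

theorem rotateTo_injective (p q : ℂ) : Function.Injective (rotateTo p q) := by
  intro ω ω' h
  have := congrArg (fun F : ℂ ≃ᵢ ℂ => F (p + 1)) h
  simp only [rotateTo_apply] at this
  exact Subtype.ext (by simpa using this)

theorem IsWedgeCovered.vertexPtOn {K : Set ℂ} {φ : ℂ → ℂ} {p : ℂ} (hK : Convex ℝ K)
    (hne : (interior K).Nonempty) (hp : p ∈ frontier K) (h : IsWedgeCovered K φ p) :
    VertexPtOn K φ p := by
  classical
  obtain ⟨U, hU, F, hF, hFw, hcov, hf⟩ := h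
  obtain ⟨α, β, hαβ, hjunk⟩ := exists_wedge_inter_subset hK hne hp
  choose! f hf using hf
  have : Finite F := hF
  obtain ⟨m, ⟨e⟩⟩ := Finite.exists_equiv_fin F
  obtain ⟨ω, hω⟩ : ∃ ω : Fin 3 → Circle, Function.Injective ω :=
    ⟨fun j => Circle.exp (j.val : ℝ), fun i j hij => by
      have hmem : ∀ j : Fin 3, -Real.pi < (j.val : ℝ) ∧ (j.val : ℝ) ≤ Real.pi := fun j => by
        have h0 : (0 : ℝ) ≤ (j.val : ℝ) := Nat.cast_nonneg _
        have h2 : (j.val : ℝ) ≤ 2 := by exact_mod_cast (by omega : j.val ≤ 2)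
        constructor <;> linarith [Real.pi_gt_three]
      have := congrArg (fun z : Circle => Complex.arg z) hij
      simp only [Circle.arg_exp (hmem _).1 (hmem _).2] at this
      exact Fin.ext (by exact_mod_cast this)⟩
  let E : Fin (m + 3) ≃ F ⊕ Fin 3 := finSumFinEquiv.symm.trans (e.symm.sumCongr (Equiv.refl _))
  let g : F ⊕ Fin 3 → ℂ ≃ᵢ ℂ := Sum.elim (fun w => f w) fun j => rotateTo p (φ p) (ω j)
  refine ⟨U, hU, m + 3, by omega, fun i => Sum.elim (fun w => w.1.1) (fun _ => α) (E i),
    fun i => Sum.elim (fun w => w.1.2) (fun _ => β) (E i), fun i => g (E i), ?_, ?_, ?_, ?_⟩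
  · intro i
    dsimp only
    rcases E i with w | j
    · exact (hFw w w.2).1
    · exact hαβ
  · intro z hz
    obtain ⟨w, hw, hzw⟩ := mem_iUnion₂.1 (hcov hz)
    refine mem_iUnion.2 ⟨E.symm (Sum.inl ⟨w, hw⟩), ?_⟩
    simpa using hzw
  · intro i
    dsimp only
    rcases E i with w | j
    · exact hf w w.2
    · rintro z ⟨⟨-, hzK⟩, hzw⟩
      obtain rfl : z = p := hjunk ⟨hzK, hzw⟩
      simp [g, rotateTo_apply]
  · have hsub : range (fun j => rotateTo p (φ p) (ω j)) ⊆ range fun i => g (E i) := by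
      rintro _ ⟨j, rfl⟩
      exact ⟨E.symm (Sum.inr j), by simp [g]⟩
    have hinj : Function.Injective fun j => rotateTo p (φ p) (ω j) :=
      (rotateTo_injective _ _).comp hω
    have hcard : (range fun j => rotateTo p (φ p) (ω j)).ncard = 3 := by
      rw [← image_univ, ncard_image_of_injective _ hinj, ncard_univ, Nat.card_eq_fintype_card,
        Fintype.card_fin]
    have hle := ncard_le_ncard hsub (finite_range _)
    rwa [hcard] at hle

/-- A chord all of whose inner points lie on a finite family of chords is one of them. -/
theorem IsChord.eq_or_eq_of_forall_mem {K : Set ℂ} (hKc : IsClosed K) (hK : Convex ℝ K)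
    {S : Finset (ℂ × ℂ)} (hS : ∀ c ∈ S, IsChord K c.1 c.2) {u v : ℂ} (huv : IsChord K u v)
    (h : ∀ p ∈ openSegment ℝ u v, ∃ c ∈ S, p ∈ openSegment ℝ c.1 c.2) :
    ∃ c ∈ S, (u = c.1 ∧ v = c.2) ∨ (u = c.2 ∧ v = c.1) := by
  have hd : v - u ≠ 0 := sub_ne_zero.2 huv.ne.symm
  have hpt : ∀ t ∈ Ioo (0 : ℝ) 1, u + t * (v - u) ∈ openSegment ℝ u v := fun t ht =>
    mem_openSegment_iff_exists_ofReal.2 ⟨t, ht.1, ht.2, rfl⟩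
  choose! c hcS hc using h
  obtain ⟨s, hs, t, ht, hst, hcst⟩ := (Ioo_infinite (zero_lt_one' ℝ)).exists_ne_map_eq_of_mapsTo
    (f := fun t : ℝ => c (u + t * (v - u))) (t := (S : Set (ℂ × ℂ)))
    (fun t ht => hcS _ (hpt t ht)) S.finite_toSet
  have hc1 := hc _ (hpt s hs)
  have hc2 := hc _ (hpt t ht)
  rw [← hcst] at hc2
  set a := c (u + s * (v - u))
  have haS : a ∈ S := hcS _ (hpt s hs)
  have ha := hS a haS
  have h1 := lineSide_eq_zero_of_mem_segment (openSegment_subset_segment ℝ _ _ hc1)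
  have h2 := lineSide_eq_zero_of_mem_segment (openSegment_subset_segment ℝ _ _ hc2)
  rw [lineSide_add_real_smul] at h1 h2
  have h3 : lineSide a.1 (a.2 - a.1) v - lineSide a.1 (a.2 - a.1) u = 0 := by
    have : (s - t) * (lineSide a.1 (a.2 - a.1) v - lineSide a.1 (a.2 - a.1) u) = 0 := by linarith
    exact (mul_eq_zero.1 this).resolve_left (sub_ne_zero.2 hst)
  have hu0 : lineSide a.1 (a.2 - a.1) u = 0 := by rw [h3] at h1; linarith
  have hend : ∀ x ∈ frontier K, lineSide a.1 (a.2 - a.1) x = 0 → x = a.1 ∨ x = a.2 := by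
    intro x hx hx0
    by_contra! hcon
    exact hx.2 (ha.subset_interior (mem_openSegment_of_ne_left_right hcon.1.symm hcon.2.symm
      (ha.mem_segment hK (hKc.frontier_subset hx) hx0)))
  have hne := huv.ne
  refine ⟨a, haS, ?_⟩
  rcases hend u huv.left_mem hu0 with h | h <;>
    rcases hend v huv.right_mem (by linarith) with h' | h'
  · exact absurd (h.trans h'.symm) hne
  · exact Or.inl ⟨h, h'⟩
  · exact Or.inr ⟨h, h'⟩
  · exact absurd (h.trans h'.symm) hne

/-- Noncrossing chords are the creases of an outer local flat folding. -/
theorem exists_isOuterLocalFlatFolding {K : Set ℂ} (hKc : IsCompact K) (hK : Convex ℝ K)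
    (hne : (interior K).Nonempty) (S : Finset (ℂ × ℂ)) (hS : ∀ c ∈ S, IsChord K c.1 c.2)
    (hdisj : ∀ c ∈ S, ∀ c' ∈ S, c ≠ c' →
      Disjoint (openSegment ℝ c.1 c.2) (openSegment ℝ c'.1 c'.2)) :
    ∃ φ : ℂ → ℂ, IsOuterLocalFlatFolding K φ ∧
      ∀ u v, IsCreaseOf K φ u v ↔ (u, v) ∈ S ∨ (v, u) ∈ S := by
  obtain ⟨φ, hφ, hunf, hcr, hw⟩ := exists_folding_of_chords hKc.isClosed hK S hS hdisj
  have hint : ∀ p ∈ interior K, UnfoldedPtOn K φ p ∨ CreasePtOn K φ p := by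
    intro p hp
    by_cases h : ∀ c ∈ S, p ∉ openSegment ℝ c.1 c.2
    · exact Or.inl (hunf p hp h)
    · push Not at h
      obtain ⟨c, hc, hpc⟩ := h
      exact Or.inr (hcr c hc p hpc)
  refine ⟨φ, ⟨hKc, hK, hne, hφ, fun p hp => ?_, fun p hp hv => ?_⟩, fun u v => ⟨?_, ?_⟩⟩
  · by_cases hpi : p ∈ interior K
    · exact (hint p hpi).imp_right Or.inl
    · have hpf : p ∈ frontier K := ⟨subset_closure hp, hpi⟩
      exact Or.inr (Or.inr ((hw p hpf).vertexPtOn hK hne hpf))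
  · refine ⟨subset_closure hp, fun hpi => ?_⟩
    exact (hint p hpi).elim (fun h => h.not_vertexPtOn hpi hv) fun h => h.not_vertexPtOn hpi hv
  · rintro ⟨hu, hv, huv, hsub, hall⟩
    obtain ⟨c, hc, h⟩ := IsChord.eq_or_eq_of_forall_mem hKc.isClosed hK hS
      ⟨hu, hv, huv, hsub⟩ fun p hp => by
        by_contra! hcon
        exact (hunf p (hsub hp) hcon).not_creasePtOn (hsub hp) (hall p hp)
    rcases h with ⟨rfl, rfl⟩ | ⟨rfl, rfl⟩
    · exact Or.inl hc
    · exact Or.inr hc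
  · rintro (h | h)
    · have hc := hS _ h
      exact ⟨hc.left_mem, hc.right_mem, hc.ne, hc.subset_interior, hcr _ h⟩
    · have hc := (hS _ h).symm
      refine ⟨hc.left_mem, hc.right_mem, hc.ne, hc.subset_interior, ?_⟩
      rw [openSegment_symm]
      exact hcr _ h

/-- The vertices of a convex polygon are extreme points. -/
theorem mem_extremePoints_of_notMem_convexHull {k : ℕ} {P : Fin k → ℂ}
    (hP : ∀ i, P i ∉ convexHull ℝ (P '' {j | j ≠ i})) (i : Fin k) :
    P i ∈ (convexHull ℝ (range P)).extremePoints ℝ := by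
  by_contra hi
  have hsub : (convexHull ℝ (range P)).extremePoints ℝ ⊆ P '' {j | j ≠ i} := by
    intro x hx
    obtain ⟨j, rfl⟩ := extremePoints_convexHull_subset hx
    exact ⟨j, fun h => hi (h ▸ hx), rfl⟩
  have hcl : IsClosed (convexHull ℝ (P '' {j | j ≠ i})) :=
    ((toFinite _).isCompact_convexHull ℝ).isClosed
  have hKM := closure_convexHull_extremePoints ((finite_range P).isCompact_convexHull ℝ)
    (convex_convexHull ℝ (range P))
  have hmem : P i ∈ convexHull ℝ (range P) := subset_convexHull ℝ _ (mem_range_self i)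
  rw [← hKM] at hmem
  exact hP i (hcl.closure_subset_iff.2 (convexHull_mono hsub) hmem)

theorem injective_of_notMem_convexHull {k : ℕ} {P : Fin k → ℂ}
    (hP : ∀ i, P i ∉ convexHull ℝ (P '' {j | j ≠ i})) : Function.Injective P := by
  intro i j h
  by_contra hij
  exact hP i (subset_convexHull ℝ _ ⟨j, Ne.symm hij, h.symm⟩)

theorem interior_convexHull_nonempty_of_notMem {k : ℕ} (hk : 3 ≤ k) {P : Fin k → ℂ}
    (hP : ∀ i, P i ∉ convexHull ℝ (P '' {j | j ≠ i})) :
    (interior (convexHull ℝ (range P))).Nonempty := by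
  have hw : ∀ i j l : Fin k, j ≠ i → j ≠ l → ¬ Wbtw ℝ (P i) (P j) (P l) := by
    intro i j l hji hjl hw
    refine hP j (segment_subset_convexHull (s := P '' {m | m ≠ j}) ⟨i, Ne.symm hji, rfl⟩
      ⟨l, Ne.symm hjl, rfl⟩ ?_)
    rwa [← affineSegment_eq_segment]
  have hcol : ¬ Collinear ℝ {P ⟨0, by omega⟩, P ⟨1, by omega⟩, P ⟨2, by omega⟩} := by
    intro h
    rcases h.wbtw_or_wbtw_or_wbtw with h | h | h <;> refine hw _ _ _ ?_ ?_ h <;> simp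
  rw [← affineIndependent_iff_not_collinear_set] at hcol
  have htop := hcol.affineSpan_eq_top_iff_card_eq_finrank_add_one.2 (by
    simp [Complex.finrank_real_complex])
  rw [interior_convexHull_nonempty_iff_affineSpan_eq_top, eq_top_iff, ← htop]
  refine affineSpan_mono ℝ ?_
  rintro _ ⟨i, rfl⟩
  fin_cases i <;> simp

theorem mem_frontier_of_mem_extremePoints {K : Set ℂ} {p : ℂ} (hp : p ∈ K.extremePoints ℝ) :
    p ∈ frontier K := by
  refine ⟨subset_closure hp.1, fun hi => ?_⟩
  obtain ⟨ε, hε, hball⟩ := Metric.isOpen_iff.1 isOpen_interior p hi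
  have h1 : p + (ε / 2 : ℝ) ∈ K := interior_subset (hball (by
    simp [abs_of_pos hε, hε]))
  have h2 : p - (ε / 2 : ℝ) ∈ K := interior_subset (hball (by
    simp [abs_of_pos hε, hε]))
  have h3 := hp.2 h1 h2 ⟨1 / 2, 1 / 2, by norm_num, by norm_num, by norm_num, by
    simp only [Complex.real_smul]; push_cast; ring⟩
  have h4 : (p + (ε / 2 : ℝ)) - p = 0 := by
    rw [sub_eq_zero]
    exact h3
  rw [add_sub_cancel_left, Complex.ofReal_eq_zero] at h4
  linarith

/-- A parametrization of the boundary of `K` by angles. -/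
structure IsBoundaryParam (K : Set ℂ) (b : ℝ → ℂ) : Prop where
  continuous : Continuous b
  mem : ∀ t, b t ∈ frontier K
  exists_eq : ∀ p ∈ frontier K, ∀ a : ℝ, ∃ t ∈ Ico a (a + 2 * Real.pi), b t = p
  eq_of_eq : ∀ s t, |s - t| < 2 * Real.pi → b s = b t → s = t
  periodic : ∀ t, b (t + 2 * Real.pi) = b t

theorem exists_isBoundaryParam {K : Set ℂ} (hKc : IsCompact K) (hK : Convex ℝ K)
    (hne : (interior K).Nonempty) : ∃ b, IsBoundaryParam K b := by
  obtain ⟨h, -, -, hfr⟩ :=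
    exists_homeomorph_image_interior_closure_frontier_eq_unitBall hK hne hKc.isBounded
  refine ⟨fun t => h.symm (Circle.exp t), ?_, ?_, ?_, ?_, ?_⟩
  · fun_prop
  · intro t
    have : (Circle.exp t : ℂ) ∈ h '' frontier K := by
      rw [hfr]
      simp
    obtain ⟨x, hx, hxt⟩ := this
    simpa [← hxt] using hx
  · intro p hp a
    have : h p ∈ Metric.sphere (0 : ℂ) 1 := hfr ▸ mem_image_of_mem h hp
    obtain ⟨t, ht, hte⟩ := Circle.periodic_exp.exists_mem_Ico Real.two_pi_pos
      (Complex.arg (h p)) a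
    refine ⟨t, ht, ?_⟩
    rw [← hte, h.symm_apply_eq, Circle.coe_exp]
    have := Complex.norm_mul_exp_arg_mul_I (h p)
    rwa [mem_sphere_zero_iff_norm.1 ‹_›, Complex.ofReal_one, one_mul] at this
  · intro s t hst he
    have := Subtype.ext (h.symm.injective he)
    obtain ⟨m, hm⟩ := Circle.exp_eq_exp.1 this
    rw [hm, add_sub_cancel_left, abs_mul, abs_of_pos Real.two_pi_pos] at hst
    have : |(m : ℝ)| < 1 := by
      by_contra! h1
      nlinarith [Real.two_pi_pos]
    have hm0 : m = 0 := by
      rw [← Int.abs_lt_one_iff]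
      exact_mod_cast this
    simpa [hm0] using hm
  · intro t
    simp [Circle.exp_two_pi]

/-- Two boundary points separated by extreme points of `K` span a chord. -/
theorem IsBoundaryParam.isChord {K : Set ℂ} {b : ℝ → ℂ} (hb : IsBoundaryParam K b)
    (hKc : IsClosed K) (hK : Convex ℝ K) {α β γ δ : ℝ} (hαγ : α < γ) (hγβ : γ < β) (hβδ : β < δ)
    (hδ : δ < α + 2 * Real.pi) (hγe : b γ ∈ K.extremePoints ℝ) (hδe : b δ ∈ K.extremePoints ℝ) :
    IsChord K (b α) (b β) := by
  have hpK : b α ∈ K := hKc.frontier_subset (hb.mem α)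
  have hqK : b β ∈ K := hKc.frontier_subset (hb.mem β)
  have hinj : ∀ s ∈ Ico α (α + 2 * Real.pi), ∀ t ∈ Ico α (α + 2 * Real.pi),
      b s = b t → s = t := fun s hs t ht h =>
    hb.eq_of_eq s t (abs_sub_lt_iff.2 ⟨by linarith [hs.2, ht.1], by linarith [hs.1, ht.2]⟩) h
  have mα : α ∈ Ico α (α + 2 * Real.pi) := ⟨le_rfl, by linarith⟩
  have mβ : β ∈ Ico α (α + 2 * Real.pi) := ⟨by linarith, by linarith⟩
  have mγ : γ ∈ Ico α (α + 2 * Real.pi) := ⟨by linarith, by linarith⟩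
  have mδ : δ ∈ Ico α (α + 2 * Real.pi) := ⟨by linarith, by linarith⟩
  have hnot : ∀ ε ∈ Ico α (α + 2 * Real.pi), b ε ∈ K.extremePoints ℝ → ε ≠ α → ε ≠ β →
      b ε ∉ segment ℝ (b α) (b β) := by
    intro ε mε hε h1 h2 hmem
    have h3 : b α ≠ b ε := fun h => h1 (hinj _ mα _ mε h).symm
    have h4 : b β ≠ b ε := fun h => h2 (hinj _ mβ _ mε h).symm
    exact h3 (hε.2 hpK hqK (mem_openSegment_of_ne_left_right h3 h4 hmem))
  refine ⟨hb.mem α, hb.mem β, fun h => (hαγ.trans hγβ).ne (hinj _ mα _ mβ h), ?_⟩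
  by_contra hcon
  have hfr : segment ℝ (b α) (b β) ⊆ frontier K := by
    intro z hz
    refine ⟨subset_closure (hK.segment_subset hpK hqK hz), fun hzi => hcon ?_⟩
    have hzp : b α ≠ z := fun h => (hb.mem α).2 (h ▸ hzi)
    have hzq : b β ≠ z := fun h => (hb.mem β).2 (h ▸ hzi)
    have hzo := mem_openSegment_of_ne_left_right hzp hzq hz
    obtain ⟨s, hs0, hs1, rfl⟩ := mem_openSegment_iff_exists_ofReal.1 hzo
    intro w hw
    obtain ⟨t, ht0, ht1, rfl⟩ := mem_openSegment_iff_exists_ofReal.1 hw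
    rcases lt_trichotomy s t with h | rfl | h
    · refine hK.openSegment_interior_self_subset_interior hzi hqK
        (mem_openSegment_iff_exists_ofReal.2 ⟨(t - s) / (1 - s), by
          apply div_pos <;> linarith, by rw [div_lt_one] <;> linarith, ?_⟩)
      have : ((1 - s : ℝ) : ℂ) ≠ 0 := by
        rw [Complex.ofReal_ne_zero]; linarith
      push_cast at this ⊢
      field_simp
      ring
    · exact hzi
    · refine hK.openSegment_interior_self_subset_interior hzi hpK
        (mem_openSegment_iff_exists_ofReal.2 ⟨(s - t) / s, by
          apply div_pos <;> linarith, by rw [div_lt_one] <;> linarith, ?_⟩)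
      have : (s : ℂ) ≠ 0 := by
        rw [Complex.ofReal_ne_zero]; linarith
      push_cast
      field_simp
      ring
  have hcov : segment ℝ (b α) (b β) ⊆ b '' Icc γ δ ∪ b '' Icc δ (γ + 2 * Real.pi) := by
    intro z hz
    obtain ⟨t, ht, rfl⟩ := hb.exists_eq z (hfr hz) γ
    rcases le_total t δ with h | h
    · exact Or.inl ⟨t, ⟨ht.1, h⟩, rfl⟩
    · exact Or.inr ⟨t, ⟨h, ht.2.le⟩, rfl⟩
  obtain ⟨z, hz, ⟨s, hs, rfl⟩, t, ht, hts⟩ := isPreconnected_closed_iff.1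
    (convex_segment (b α) (b β)).isPreconnected _ _
    (isCompact_Icc.image hb.continuous).isClosed (isCompact_Icc.image hb.continuous).isClosed hcov
    ⟨b β, right_mem_segment ℝ _ _, β, ⟨hγβ.le, hβδ.le⟩, rfl⟩
    ⟨b α, left_mem_segment ℝ _ _, α + 2 * Real.pi, ⟨hδ.le, by linarith⟩, hb.periodic α⟩
  have hst : s = γ ∨ s = δ := by
    by_cases hst : |t - s| < 2 * Real.pi
    · have := hb.eq_of_eq t s hst hts
      exact Or.inr (le_antisymm hs.2 (this ▸ ht.1))
    · rw [abs_of_nonneg (by linarith [hs.2, ht.1])] at hst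
      exact Or.inl (by linarith [ht.2, hs.1])
  rcases hst with rfl | rfl
  · exact hnot _ mγ hγe hαγ.ne' hγβ.ne hz
  · exact hnot _ mδ hδe (by linarith) hβδ.ne' hz

/-- A chord does not meet the chords spanned by one of the two arcs it cuts off. -/
theorem IsBoundaryParam.disjoint_openSegment {K : Set ℂ} {b : ℝ → ℂ} (hb : IsBoundaryParam K b)
    (hKc : IsClosed K) (hK : Convex ℝ K) {α β γ δ : ℝ} (hβ : β < α + 2 * Real.pi)
    (hch : IsChord K (b α) (b β)) (hγ : γ ∈ Ioo α β) (hδ : δ ∈ Icc α β) :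
    Disjoint (openSegment ℝ (b α) (b β)) (openSegment ℝ (b γ) (b δ)) := by
  set f : ℝ → ℝ := fun t => lineSide (b α) (b β - b α) (b t) with hf
  have hfc : Continuous f := (continuous_lineSide _ _).comp hb.continuous
  have hf0 : ∀ t ∈ Ioo α β, f t ≠ 0 := by
    intro t ht h0
    have hmem := hch.mem_segment hK (hKc.frontier_subset (hb.mem t)) h0
    refine (hb.mem t).2 (hch.subset_interior (mem_openSegment_of_ne_left_right ?_ ?_ hmem))
    · intro h
      have := hb.eq_of_eq α t (abs_sub_lt_iff.2 ⟨by linarith [ht.1, ht.2], by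
        linarith [ht.1, ht.2]⟩) h
      exact ht.1.ne this
    · intro h
      have := hb.eq_of_eq β t (abs_sub_lt_iff.2 ⟨by linarith [ht.1, ht.2], by
        linarith [ht.1, ht.2]⟩) h
      exact ht.2.ne this.symm
  have hsign : ∀ t ∈ Ioo α β, 0 < f t * f γ := by
    intro t ht
    by_contra! hneg
    have hg : Continuous fun s => f s * f γ := hfc.mul continuous_const
    obtain ⟨s, hs, hs0⟩ := isPreconnected_Ioo.intermediate_value ht hγ hg.continuousOn
      ⟨hneg, (mul_self_pos.2 (hf0 γ hγ)).le⟩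
    exact (mul_ne_zero (hf0 s hs) (hf0 γ hγ)) hs0
  have hδ' : 0 ≤ f δ * f γ := by
    rcases hδ.1.eq_or_lt with rfl | h1
    · simp [hf, lineSide_eq]
    rcases hδ.2.eq_or_lt with rfl | h2
    · simp only [hf, lineSide_eq, Complex.sub_re, Complex.sub_im]
      exact le_of_eq (by ring)
    · exact (hsign δ ⟨h1, h2⟩).le
  rw [Set.disjoint_left]
  intro z hz hz'
  have hz0 := lineSide_eq_zero_of_mem_segment (openSegment_subset_segment ℝ _ _ hz)
  obtain ⟨s, hs0, hs1, rfl⟩ := mem_openSegment_iff_exists_ofReal.1 hz'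
  rw [lineSide_add_real_smul] at hz0
  change f γ + s * (f δ - f γ) = 0 at hz0
  have : (1 - s) * (f γ * f γ) + s * (f δ * f γ) = 0 := by linear_combination f γ * hz0
  have h1 : 0 < (1 - s) * (f γ * f γ) := mul_pos (by linarith) (hsign γ hγ)
  have h2 : 0 ≤ s * (f δ * f γ) := mul_nonneg hs0.le hδ'
  linarith

/-- Chords whose angles do not interlace are disjoint. -/
theorem IsBoundaryParam.disjoint_of_not_interlace {K : Set ℂ} {b : ℝ → ℂ}
    (hb : IsBoundaryParam K b) (hKc : IsClosed K) (hK : Convex ℝ K) {θ α β γ δ : ℝ}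
    (hα : α ∈ Ioo θ (θ + 2 * Real.pi)) (hβ : β ∈ Ioo θ (θ + 2 * Real.pi))
    (hγ : γ ∈ Ioo θ (θ + 2 * Real.pi)) (hδ : δ ∈ Ioo θ (θ + 2 * Real.pi))
    (hαβ : α < β) (hγδ : γ < δ) (hch : IsChord K (b α) (b β)) (hne : ¬ (α = γ ∧ β = δ))
    (h1 : ¬ (α < γ ∧ γ < β ∧ β < δ)) (h2 : ¬ (γ < α ∧ α < δ ∧ δ < β)) :
    Disjoint (openSegment ℝ (b α) (b β)) (openSegment ℝ (b γ) (b δ)) := by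
  obtain ⟨hα1, hα2⟩ := hα
  obtain ⟨hβ1, hβ2⟩ := hβ
  obtain ⟨hγ1, hγ2⟩ := hγ
  obtain ⟨hδ1, hδ2⟩ := hδ
  have hin : ∀ x ∈ Ioo α β, ∀ y ∈ Icc α β,
      Disjoint (openSegment ℝ (b α) (b β)) (openSegment ℝ (b x) (b y)) := fun x hx y hy =>
    hb.disjoint_openSegment hKc hK (by linarith) hch hx hy
  have hout : ∀ x ∈ Ioo β (α + 2 * Real.pi), ∀ y ∈ Icc β (α + 2 * Real.pi),
      Disjoint (openSegment ℝ (b α) (b β)) (openSegment ℝ (b x) (b y)) := fun x hx y hy => by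
    have := hb.disjoint_openSegment hKc hK (α := β) (β := α + 2 * Real.pi) (by linarith)
      (by rw [hb.periodic]; exact hch.symm) hx hy
    rwa [hb.periodic, openSegment_symm] at this
  have hsw : ∀ x y, openSegment ℝ (b x) (b y) = openSegment ℝ (b y) (b x) := fun x y =>
    openSegment_symm ℝ _ _
  by_cases hγin : α < γ ∧ γ < β
  · exact hin γ hγin δ ⟨by linarith, by by_contra! h; exact h1 ⟨hγin.1, hγin.2, h⟩⟩
  by_cases hδin : α < δ ∧ δ < β
  · rw [hsw γ δ]
    exact hin δ hδin γ ⟨by by_contra! h; exact h2 ⟨h, hδin.1, hδin.2⟩, by linarith⟩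
  rcases le_or_gt β γ with hc | hc
  · rw [hsw γ δ]
    exact hout δ ⟨by linarith, by linarith⟩ γ ⟨hc, by linarith⟩
  have hγα : γ ≤ α := by
    by_contra! h
    exact hγin ⟨h, hc⟩
  rcases le_or_gt δ α with hd | hd
  · rw [← hb.periodic γ, ← hb.periodic δ]
    exact hout _ ⟨by linarith, by linarith⟩ _ ⟨by linarith, by linarith⟩
  have hβδ : β ≤ δ := by
    by_contra! h
    exact hδin ⟨hd, h⟩
  rcases hγα.lt_or_eq with h | h
  · rw [← hb.periodic γ]
    exact hout _ ⟨by linarith, by linarith⟩ _ ⟨by linarith, by linarith⟩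
  · rw [hsw γ δ, ← hb.periodic γ]
    have : β < δ := lt_of_le_of_ne hβδ fun h' => hne ⟨h.symm, h'⟩
    exact hout _ ⟨by linarith, by linarith⟩ _ ⟨by linarith, by linarith⟩

section Rooting

variable {V : Type} {T : SimpleGraph V}

theorem isTree_existsUnique_parent (hT : T.IsTree) {r v : V} (hv : v ≠ r) :
    ∃! w, T.Adj v w ∧ T.dist v r = T.dist w r + 1 := by
  have key : ∀ w, T.Adj v w ∧ T.dist v r = T.dist w r + 1 →
      ∃ q : T.Walk v r, q.IsPath ∧ q.snd = w := by
    rintro w ⟨hadj, hd⟩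
    obtain ⟨q, hq⟩ := (hT.connected w r).exists_walk_length_eq_dist
    exact ⟨q.cons hadj, SimpleGraph.Walk.isPath_of_length_eq_dist _ (by simp [hq, hd]), by simp⟩
  obtain ⟨p, hp⟩ := (hT.connected v r).exists_walk_length_eq_dist
  cases p with
  | nil => exact absurd rfl hv
  | @cons _ w _ hadj q =>
    have hd : T.dist v r = T.dist w r + 1 := by
      have h1 := SimpleGraph.dist_le q
      rw [SimpleGraph.Walk.length_cons] at hp
      rcases hT.dist_eq_dist_add_one_of_adj r hadj with h | h <;>
        rw [T.dist_comm (u := r) (v := v), T.dist_comm (u := r) (v := w)] at h <;> omega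
    refine ⟨w, ⟨hadj, hd⟩, fun y hy => ?_⟩
    obtain ⟨q₁, hq₁, rfl⟩ := key y hy
    obtain ⟨q₂, hq₂, rfl⟩ := key w ⟨hadj, hd⟩
    rw [(hT.existsUnique_path v r).unique hq₁ hq₂]

/-- A parent function for the graph `T` rooted at `r`, with a compatible depth. -/
structure IsRooting (T : SimpleGraph V) (r : V) (par : V → V) (depth : V → ℕ) : Prop where
  par_root : par r = r
  depth_eq : ∀ v, v ≠ r → depth v = depth (par v) + 1
  adj_iff : ∀ v w, T.Adj v w ↔ (v ≠ r ∧ par v = w) ∨ (w ≠ r ∧ par w = v)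

theorem exists_isRooting (hT : T.IsTree) (r : V) : ∃ par depth, IsRooting T r par depth := by
  classical
  have h : ∀ v, ∃ w, (v = r → w = r) ∧ (v ≠ r → T.Adj v w ∧ T.dist v r = T.dist w r + 1) := by
    intro v
    by_cases hv : v = r
    · exact ⟨r, fun _ => rfl, fun h => absurd hv h⟩
    · obtain ⟨w, hw, -⟩ := isTree_existsUnique_parent hT hv
      exact ⟨w, fun h => absurd h hv, fun _ => hw⟩
  choose par h1 h2 using h
  have hup : ∀ v w, T.Adj v w → T.dist v r = T.dist w r + 1 → v ≠ r ∧ par v = w := by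
    intro v w hadj hd
    have hv : v ≠ r := by
      rintro rfl
      simp at hd
    exact ⟨hv, (isTree_existsUnique_parent hT hv).unique (h2 v hv) ⟨hadj, hd⟩⟩
  refine ⟨par, fun v => T.dist v r, h1 r rfl, fun v hv => (h2 v hv).2, fun v w => ⟨fun hadj => ?_, ?_⟩⟩
  · rcases hT.dist_eq_dist_add_one_of_adj r hadj with h | h <;>
      rw [T.dist_comm (u := r) (v := v), T.dist_comm (u := r) (v := w)] at h
    · exact Or.inl (hup v w hadj h)
    · exact Or.inr (hup w v hadj.symm h)
  · rintro (⟨hv, rfl⟩ | ⟨hw, rfl⟩)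
    · exact (h2 v hv).1
    · exact (h2 w hw).1.symm

variable {r : V} {par : V → V} {depth : V → ℕ}

/-- The descendants of `v` for the parent function `par`. -/
def descendants (par : V → V) (v : V) : Set V := {w | ∃ n, par^[n] w = v}

theorem self_mem_descendants (v : V) : v ∈ descendants par v := ⟨0, rfl⟩

theorem mem_descendants_of_par_mem {v w : V} (h : par w ∈ descendants par v) :
    w ∈ descendants par v := by
  obtain ⟨n, hn⟩ := h
  exact ⟨n + 1, hn⟩

theorem par_mem_descendants {v w : V} (h : w ∈ descendants par v) (hne : w ≠ v) :
    par w ∈ descendants par v := by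
  obtain ⟨n, hn⟩ := h
  cases n with
  | zero => exact absurd hn hne
  | succ n => exact ⟨n, hn⟩

/-- The children of `v`. -/
def childSet (r : V) (par : V → V) (v : V) : Set V := {u | u ≠ r ∧ par u = v}

theorem descendants_subset (hr : par r = r) (v : V) :
    descendants par v ⊆ {v} ∪ ⋃ u ∈ childSet r par v, descendants par u := by
  rintro w ⟨n, hn⟩
  induction n generalizing w with
  | zero => exact Or.inl hn
  | succ n ih =>
    rcases ih hn with h | h
    · by_cases hwr : w = r
      · exact Or.inl (by rwa [hwr, hr, ← hwr] at h)
      · exact Or.inr (mem_iUnion₂.2 ⟨w, ⟨hwr, h⟩, self_mem_descendants w⟩)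
    · obtain ⟨u, hu, hm⟩ := mem_iUnion₂.1 h
      exact Or.inr (mem_iUnion₂.2 ⟨u, hu, mem_descendants_of_par_mem hm⟩)

theorem descendants_subset_of_mem_childSet {u v : V} (hu : u ∈ childSet r par v) :
    descendants par u ⊆ descendants par v := by
  rintro w ⟨n, hn⟩
  exact ⟨n + 1, by rw [Function.iterate_succ_apply', hn, hu.2]⟩

theorem descendants_eq (hr : par r = r) (v : V) :
    descendants par v = {v} ∪ ⋃ u ∈ childSet r par v, descendants par u := by
  refine (descendants_subset hr v).antisymm (union_subset ?_ (iUnion₂_subset fun u hu => ?_))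
  · exact singleton_subset_iff.2 (self_mem_descendants v)
  · exact descendants_subset_of_mem_childSet hu

namespace IsRooting

variable (hR : IsRooting T r par depth)
include hR

theorem depth_iterate_le (n : ℕ) (v : V) : depth (par^[n] v) ≤ depth v := by
  induction n generalizing v with
  | zero => exact le_rfl
  | succ n ih =>
    refine (ih (par v)).trans ?_
    by_cases hv : v = r
    · rw [hv, hR.par_root]
    · have := hR.depth_eq v hv
      omega

theorem depth_le_of_mem_descendants {v w : V} (h : w ∈ descendants par v) :
    depth v ≤ depth w := by
  obtain ⟨n, rfl⟩ := h
  exact hR.depth_iterate_le n w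

theorem depth_of_mem_childSet {u v : V} (hu : u ∈ childSet r par v) : depth u = depth v + 1 := by
  rw [hR.depth_eq u hu.1, hu.2]

theorem notMem_descendants_of_mem_childSet {u v : V} (hu : u ∈ childSet r par v) :
    v ∉ descendants par u := by
  intro h
  have h1 := hR.depth_le_of_mem_descendants h
  have h2 := hR.depth_of_mem_childSet hu
  omega

theorem disjoint_descendants {u u' v : V} (hu : u ∈ childSet r par v)
    (hu' : u' ∈ childSet r par v) (hne : u ≠ u') :
    Disjoint (descendants par u) (descendants par u') := by
  have key : ∀ u ∈ childSet r par v, ∀ u' ∈ childSet r par v, u ≠ u' → ∀ m k w,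
      par^[m] w = u → par^[m + k] w ≠ u' := by
    intro u hu u' hu' hne m k w hm hk
    rw [Nat.add_comm, Function.iterate_add_apply, hm] at hk
    cases k with
    | zero => exact hne hk
    | succ k =>
      rw [Function.iterate_succ_apply, hu.2] at hk
      have h1 := hR.depth_iterate_le k v
      have h2 := hR.depth_of_mem_childSet hu'
      rw [hk] at h1
      omega
  rw [Set.disjoint_left]
  rintro w ⟨m, hm⟩ ⟨n, hn⟩
  rcases le_total m n with h | h
  · exact key u hu u' hu' hne m (n - m) w hm (by rwa [Nat.add_sub_cancel' h])
  · exact key u' hu' u hu hne.symm n (m - n) w hn (by rwa [Nat.add_sub_cancel' h])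

/-- The only edge leaving the set of descendants of `u` goes from `u` to its parent. -/
theorem eq_of_adj {u v c d : V} (hu : u ∈ childSet r par v) (hc : c ∉ descendants par u)
    (hd : d ∈ descendants par u) (h : T.Adj c d) : c = v ∧ d = u := by
  rcases (hR.adj_iff c d).1 h with ⟨-, rfl⟩ | ⟨-, rfl⟩
  · exact absurd (mem_descendants_of_par_mem hd) hc
  · by_cases hdu : d = u
    · exact ⟨hdu ▸ hu.2, hdu⟩
    · exact absurd (par_mem_descendants hd hdu) hc

theorem descendants_root : descendants par r = univ := by
  have : ∀ n v, depth v = n → v ∈ descendants par r := by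
    intro n
    induction n with
    | zero =>
      intro v hv
      by_cases h : v = r
      · exact h ▸ self_mem_descendants v
      · have := hR.depth_eq v h
        omega
    | succ n ih =>
      intro v hv
      by_cases h : v = r
      · exact h ▸ self_mem_descendants v
      · have := hR.depth_eq v h
        exact mem_descendants_of_par_mem (ih _ (by omega))
  exact eq_univ_of_forall fun v => this _ v rfl

end IsRooting

end Rooting

section Layout

variable {V : Type} {T : SimpleGraph V}

/-- An injective placement `x` of the vertices in `S` on the line such that the edges of `T`
inside `S` do not cross and each of them is separated by a point of `Θ`. -/
structure IsLayout (T : SimpleGraph V) (S : Set V) (Θ : Finset ℝ) (x : V → ℝ) : Prop where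
  injOn : InjOn x S
  exists_between : ∀ c ∈ S, ∀ d ∈ S, T.Adj c d → x c < x d → ∃ θ ∈ Θ, x c < θ ∧ θ < x d
  noncrossing : ∀ c ∈ S, ∀ d ∈ S, ∀ e ∈ S, ∀ f ∈ S, T.Adj c d → T.Adj e f →
    ¬ (x c < x e ∧ x e < x d ∧ x d < x f)

/-- The vertices of `S` can be laid out in any interval containing at least `n` marked points,
with `v` placed last, and behind some marked point when `n` is positive. -/
def Layoutable (T : SimpleGraph V) (S : Set V) (v : V) (n : ℕ) : Prop :=
  ∀ a b : ℝ, a < b → ∀ Θ : Finset ℝ, (∀ θ ∈ Θ, θ ∈ Ioo a b) → n ≤ Θ.card →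
    ∃ x : V → ℝ, IsLayout T S Θ x ∧ MapsTo x S (Ioo a b) ∧ (∀ w ∈ S, x w ≤ x v) ∧
      (n ≠ 0 → ∃ θ ∈ Θ, θ < x v)

theorem IsLayout.mono {S : Set V} {Θ Θ' : Finset ℝ} {x : V → ℝ} (h : IsLayout T S Θ x)
    (hΘ : Θ ⊆ Θ') : IsLayout T S Θ' x :=
  ⟨h.injOn, fun c hc d hd hcd hlt => by
    obtain ⟨θ, hθ, h1⟩ := h.exists_between c hc d hd hcd hlt
    exact ⟨θ, hΘ hθ, h1⟩, h.noncrossing⟩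

theorem Layoutable.mono {S : Set V} {v : V} {m n : ℕ} (h : Layoutable T S v m) (hmn : m ≤ n)
    (hm : m ≠ 0) : Layoutable T S v n := by
  intro a b hab Θ hΘ hn
  obtain ⟨x, h1, h2, h3, h4⟩ := h a b hab Θ hΘ (hmn.trans hn)
  exact ⟨x, h1, h2, h3, fun _ => h4 hm⟩

theorem layoutable_singleton (v : V) (n : ℕ) : Layoutable T {v} v n := by
  intro a b hab Θ hΘ hn
  obtain ⟨y, hy, hyΘ⟩ : ∃ y ∈ Ioo a b, ∀ θ ∈ Θ, θ < y := by
    rcases Θ.eq_empty_or_nonempty with rfl | hne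
    · obtain ⟨y, hy⟩ := exists_between hab
      exact ⟨y, hy, by simp⟩
    · obtain ⟨y, hy⟩ := exists_between (hΘ _ (Θ.max'_mem hne)).2
      exact ⟨y, ⟨(hΘ _ (Θ.max'_mem hne)).1.trans hy.1, hy.2⟩, fun θ hθ =>
        (Θ.le_max' θ hθ).trans_lt hy.1⟩
  refine ⟨fun _ => y, ⟨injOn_singleton _ _, ?_, ?_⟩, fun _ _ => hy, fun _ _ => le_rfl, ?_⟩
  · intro c _ d _ _ h
    exact absurd h (lt_irrefl _)
  · intro c _ d _ e _ f _ _ _ h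
    exact lt_irrefl _ h.1
  · intro hn0
    obtain ⟨θ, hθ⟩ := Finset.card_pos.1 (by omega : 0 < Θ.card)
    exact ⟨θ, hθ, hyΘ θ hθ⟩

/-- A layout with `v` placed first, obtained by reflection. -/
theorem Layoutable.exists_first {S : Set V} {v : V} {n : ℕ} (h : Layoutable T S v n) {a b : ℝ}
    (hab : a < b) {Θ : Finset ℝ} (hΘ : ∀ θ ∈ Θ, θ ∈ Ioo a b) (hn : n ≤ Θ.card) :
    ∃ x : V → ℝ, IsLayout T S Θ x ∧ MapsTo x S (Ioo a b) ∧ (∀ w ∈ S, x v ≤ x w) ∧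
      (n ≠ 0 → ∃ θ ∈ Θ, x v < θ) := by
  classical
  obtain ⟨x, h1, h2, h3, h4⟩ := h (-b) (-a) (neg_lt_neg hab) (Θ.image Neg.neg)
    (by
      simp only [Finset.mem_image]
      rintro _ ⟨θ, hθ, rfl⟩
      exact ⟨neg_lt_neg (hΘ θ hθ).2, neg_lt_neg (hΘ θ hθ).1⟩)
    (by rwa [Finset.card_image_of_injective _ neg_injective])
  have hmem : ∀ θ ∈ Θ.image Neg.neg, -θ ∈ Θ := by
    simp only [Finset.mem_image]
    rintro _ ⟨θ, hθ, rfl⟩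
    rwa [neg_neg]
  refine ⟨fun w => -x w, ⟨?_, ?_, ?_⟩, ?_, ?_, ?_⟩
  · intro c hc d hd hcd
    exact h1.injOn hc hd (neg_injective hcd)
  · intro c hc d hd hcd hlt
    obtain ⟨θ, hθ, hθ1, hθ2⟩ := h1.exists_between d hd c hc hcd.symm (neg_lt_neg_iff.1 hlt)
    exact ⟨-θ, hmem θ hθ, neg_lt_neg hθ2, neg_lt_neg hθ1⟩
  · rintro c hc d hd e he f hf hcd hef ⟨h1', h2', h3'⟩
    exact h1.noncrossing f hf e he d hd c hc hef.symm hcd.symm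
      ⟨neg_lt_neg_iff.1 h3', neg_lt_neg_iff.1 h2', neg_lt_neg_iff.1 h1'⟩
  · intro w hw
    exact ⟨lt_neg_of_lt_neg (h2 hw).2, neg_lt_of_neg_lt (h2 hw).1⟩
  · exact fun w hw => neg_le_neg (h3 w hw)
  · intro hn0
    obtain ⟨θ, hθ, hlt⟩ := h4 hn0
    exact ⟨-θ, hmem θ hθ, neg_lt_neg hlt⟩

theorem exists_split (m n : ℕ) {a b : ℝ} (hab : a < b) {Θ : Finset ℝ}
    (hΘ : ∀ θ ∈ Θ, θ ∈ Ioo a b) (hc : m + n ≤ Θ.card) :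
    ∃ c ∈ Ioo a b, m ≤ (Θ.filter (· < c)).card ∧ n ≤ (Θ.filter (c < ·)).card := by
  induction m generalizing a Θ with
  | zero =>
    obtain ⟨c, hc', hcΘ⟩ : ∃ c ∈ Ioo a b, ∀ θ ∈ Θ, c < θ := by
      rcases Θ.eq_empty_or_nonempty with rfl | hne
      · obtain ⟨y, hy⟩ := exists_between hab
        exact ⟨y, hy, by simp⟩
      · obtain ⟨y, hy⟩ := exists_between (hΘ _ (Θ.min'_mem hne)).1
        exact ⟨y, ⟨hy.1, hy.2.trans (hΘ _ (Θ.min'_mem hne)).2⟩, fun θ hθ =>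
          hy.2.trans_le (Θ.min'_le θ hθ)⟩
    refine ⟨c, hc', Nat.zero_le _, ?_⟩
    rw [Finset.filter_true_of_mem hcΘ]
    omega
  | succ m ih =>
    have hne : Θ.Nonempty := Finset.card_pos.1 (by omega)
    set θ := Θ.min' hne
    have hθ : θ ∈ Θ := Θ.min'_mem hne
    obtain ⟨c, hc', h1, h2⟩ := ih (hΘ θ hθ).2 (Θ := Θ.erase θ)
      (fun t ht => ⟨lt_of_le_of_ne (Θ.min'_le t (Finset.mem_of_mem_erase ht))
        (Finset.ne_of_mem_erase ht).symm, (hΘ t (Finset.mem_of_mem_erase ht)).2⟩)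
      (by rw [Finset.card_erase_of_mem hθ]; omega)
    refine ⟨c, ⟨(hΘ θ hθ).1.trans hc'.1, hc'.2⟩, ?_, h2.trans (Finset.card_le_card
      (Finset.filter_subset_filter _ (Finset.erase_subset _ _)))⟩
    have hsub : insert θ ((Θ.erase θ).filter (· < c)) ⊆ Θ.filter (· < c) := by
      intro t ht
      rcases Finset.mem_insert.1 ht with rfl | ht
      · exact Finset.mem_filter.2 ⟨hθ, hc'.1⟩
      · exact Finset.filter_subset_filter _ (Finset.erase_subset _ _) ht
    have := Finset.card_le_card hsub
    rw [Finset.card_insert_of_notMem (by simp)] at this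
    omega

/-- Attaching a subtree with root `u` to `v`. -/
theorem Layoutable.union {S₁ S₂ : Set V} {v u : V} {m n : ℕ} (h₁ : Layoutable T S₁ v m)
    (h₂ : Layoutable T S₂ u n) (hv : v ∈ S₁) (hu : u ∈ S₂) (hdisj : Disjoint S₁ S₂)
    (hadj : ∀ c ∈ S₁, ∀ d ∈ S₂, T.Adj c d → c = v ∧ d = u) (hmn : m + n ≠ 0) :
    Layoutable T (S₁ ∪ S₂) v (m + n) := by
  classical
  intro a b hab Θ hΘ hcard
  obtain ⟨p, hp, hp2, hp1⟩ := exists_split n m hab hΘ (by omega)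
  obtain ⟨x₁, hl₁, hm₁, hv₁, hθ₁⟩ := h₁ p b hp.2 (Θ.filter (p < ·)) (fun θ hθ => by
    rw [Finset.mem_filter] at hθ
    exact ⟨hθ.2, (hΘ θ hθ.1).2⟩) hp1
  obtain ⟨x₂, hl₂, hm₂, hu₂, hθ₂⟩ := h₂.exists_first hp.1 (Θ := Θ.filter (· < p)) (fun θ hθ => by
    rw [Finset.mem_filter] at hθ
    exact ⟨(hΘ θ hθ.1).1, hθ.2⟩) hp2
  have hn1 : ∀ w ∈ S₁, w ∉ S₂ := fun w hw => Set.disjoint_left.1 hdisj hw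
  set x : V → ℝ := S₂.piecewise x₂ x₁ with hx
  have e₁ : ∀ w ∈ S₁, x w = x₁ w := fun w hw => piecewise_eq_of_notMem _ _ _ (hn1 w hw)
  have e₂ : ∀ w ∈ S₂, x w = x₂ w := fun w hw => piecewise_eq_of_mem _ _ _ hw
  have hgt : ∀ w ∈ S₁, p < x w := fun w hw => by rw [e₁ w hw]; exact (hm₁ hw).1
  have hlt : ∀ w ∈ S₂, x w < p := fun w hw => by rw [e₂ w hw]; exact (hm₂ hw).2
  have hmax : ∀ w ∈ S₁ ∪ S₂, x w ≤ x v := by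
    rintro w (hw | hw)
    · rw [e₁ w hw, e₁ v hv]
      exact hv₁ w hw
    · exact ((hlt w hw).trans (hgt v hv)).le
  have hmin : ∀ w ∈ S₁ ∪ S₂, x u ≤ x w := by
    rintro w (hw | hw)
    · exact ((hlt u hu).trans (hgt w hw)).le
    · rw [e₂ w hw, e₂ u hu]
      exact hu₂ w hw
  have hl₁' : IsLayout T S₁ Θ x := by
    have := hl₁.mono (Finset.filter_subset _ _)
    refine ⟨this.injOn.congr fun w hw => (e₁ w hw).symm, fun c hc d hd => ?_,
      fun c hc d hd e he f hf => ?_⟩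
    · rw [e₁ c hc, e₁ d hd]
      exact this.exists_between c hc d hd
    · rw [e₁ c hc, e₁ d hd, e₁ e he, e₁ f hf]
      exact this.noncrossing c hc d hd e he f hf
  have hl₂' : IsLayout T S₂ Θ x := by
    have := hl₂.mono (Finset.filter_subset _ _)
    refine ⟨this.injOn.congr fun w hw => (e₂ w hw).symm, fun c hc d hd => ?_,
      fun c hc d hd e he f hf => ?_⟩
    · rw [e₂ c hc, e₂ d hd]
      exact this.exists_between c hc d hd
    · rw [e₂ c hc, e₂ d hd, e₂ e he, e₂ f hf]
      exact this.noncrossing c hc d hd e he f hf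
  have hmid : ∃ θ ∈ Θ, x u < θ ∧ θ < x v := by
    by_cases hm : m = 0
    · obtain ⟨θ, hθ, h⟩ := hθ₂ (by omega)
      rw [Finset.mem_filter] at hθ
      exact ⟨θ, hθ.1, by rwa [e₂ u hu], hθ.2.trans (hgt v hv)⟩
    · obtain ⟨θ, hθ, h⟩ := hθ₁ hm
      rw [Finset.mem_filter] at hθ
      exact ⟨θ, hθ.1, (hlt u hu).trans hθ.2, by rwa [e₁ v hv]⟩
  have hedge : ∀ c ∈ S₁ ∪ S₂, ∀ d ∈ S₁ ∪ S₂, T.Adj c d → x c < x d →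
      (c ∈ S₁ ∧ d ∈ S₁) ∨ (c ∈ S₂ ∧ d ∈ S₂) ∨ (c = u ∧ d = v) := by
    rintro c (hc | hc) d (hd | hd) hcd hlt'
    · exact Or.inl ⟨hc, hd⟩
    · exact absurd ((hlt d hd).trans (hgt c hc)) (not_lt.2 hlt'.le)
    · obtain ⟨h, h'⟩ := hadj d hd c hc hcd.symm
      exact Or.inr (Or.inr ⟨h', h⟩)
    · exact Or.inr (Or.inl ⟨hc, hd⟩)
  refine ⟨x, ⟨?_, ?_, ?_⟩, ?_, hmax, fun _ => ?_⟩
  · rintro c (hc | hc) d (hd | hd) hcd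
    · exact hl₁'.injOn hc hd hcd
    · exact absurd hcd ((hlt d hd).trans (hgt c hc)).ne'
    · exact absurd hcd ((hlt c hc).trans (hgt d hd)).ne
    · exact hl₂'.injOn hc hd hcd
  · intro c hc d hd hcd hlt'
    rcases hedge c hc d hd hcd hlt' with ⟨hc, hd⟩ | ⟨hc, hd⟩ | ⟨rfl, rfl⟩
    · exact hl₁'.exists_between c hc d hd hcd hlt'
    · exact hl₂'.exists_between c hc d hd hcd hlt'
    · exact hmid
  · rintro c hc d hd e he f hf hcd hef ⟨h1, h2, h3⟩
    rcases hedge c hc d hd hcd (h1.trans h2) with ⟨hc', hd'⟩ | ⟨hc', hd'⟩ | ⟨rfl, rfl⟩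
    · rcases hedge e he f hf hef (h2.trans h3) with ⟨he', hf'⟩ | ⟨he', hf'⟩ | ⟨rfl, rfl⟩
      · exact hl₁'.noncrossing c hc' d hd' e he' f hf' hcd hef ⟨h1, h2, h3⟩
      · linarith [hgt c hc', hlt e he']
      · exact (hmin c hc).not_gt h1
    · rcases hedge e he f hf hef (h2.trans h3) with ⟨he', hf'⟩ | ⟨he', hf'⟩ | ⟨rfl, rfl⟩
      · linarith [hlt d hd', hgt e he']
      · exact hl₂'.noncrossing c hc' d hd' e he' f hf' hcd hef ⟨h1, h2, h3⟩
      · exact (hmin c hc).not_gt h1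
    · exact (hmax f hf).not_gt h3
  · rintro w (hw | hw)
    · rw [e₁ w hw]
      exact ⟨hp.1.trans (hm₁ hw).1, (hm₁ hw).2⟩
    · rw [e₂ w hw]
      exact ⟨(hm₂ hw).1, (hm₂ hw).2.trans hp.2⟩
  · obtain ⟨θ, hθ, -, h⟩ := hmid
    exact ⟨θ, hθ, h⟩

end Layout

section RootedLayout

variable {V : Type} {T : SimpleGraph V} {r : V} {par : V → V} {depth : V → ℕ}

/-- The vertices that have children, none of which has children. -/
def lastBranchings (r : V) (par : V → V) : Set V :=
  {w | (childSet r par w).Nonempty ∧ ∀ u ∈ childSet r par w, childSet r par u = ∅}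

theorem IsRooting.layoutable_union_descendants (hR : IsRooting T r par depth) (f : V → ℕ)
    {v : V} {S : Set V} {n : ℕ} (hv : v ∈ S) (hS : Layoutable T S v n)
    (C : Finset V) (hC : ∀ u ∈ C, u ∈ childSet r par v)
    (hdisj : ∀ u ∈ C, Disjoint S (descendants par u))
    (hpos : ∀ u ∈ C, n + f u ≠ 0)
    (hlay : ∀ u ∈ C, Layoutable T (descendants par u) u (f u)) :
    Layoutable T (S ∪ ⋃ u ∈ C, descendants par u) v (n + ∑ u ∈ C, f u) := by
  classical
  induction C using Finset.induction_on with
  | empty => simpa using hS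
  | insert u C hu ih =>
    simp only [Finset.forall_mem_insert] at hC hdisj hpos hlay
    have hd : Disjoint (S ∪ ⋃ u ∈ C, descendants par u) (descendants par u) := by
      simp only [disjoint_union_left, disjoint_iUnion_left]
      exact ⟨hdisj.1, fun w hw => hR.disjoint_descendants (hC.2 w hw) hC.1
        fun h => hu (h ▸ hw)⟩
    have := (ih hC.2 hdisj.2 hpos.2 hlay.2).union hlay.1 (Or.inl hv)
      (self_mem_descendants u) hd (fun c hc d hd' hcd =>
        hR.eq_of_adj hC.1 (Set.disjoint_left.1 hd hc) hd' hcd) (by have := hpos.1; omega)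
    rw [Finset.sum_insert hu, Finset.set_biUnion_insert, union_comm (descendants par u),
      ← union_assoc, add_comm (f u), ← add_assoc]
    exact this

theorem descendants_of_childSet_eq_empty (hr : par r = r) {v : V}
    (h : childSet r par v = ∅) : descendants par v = {v} := by
  rw [descendants_eq hr, h]
  simp

theorem IsRooting.layoutable_descendants [Finite V] (hR : IsRooting T r par depth) (v : V) :
    Layoutable T (descendants par v) v (lastBranchings r par ∩ descendants par v).ncard ∧
      ((childSet r par v).Nonempty →
        (lastBranchings r par ∩ descendants par v).ncard ≠ 0) := by
  classical
  have := Fintype.ofFinite V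
  set Z := lastBranchings r par with hZ
  obtain ⟨N, hN⟩ : ∃ N, ∀ v, depth v < N :=
    ⟨Finset.univ.sup depth + 1, fun v => Nat.lt_succ_of_le (Finset.le_sup (Finset.mem_univ v))⟩
  suffices H : ∀ n v, N ≤ depth v + n →
      Layoutable T (descendants par v) v (Z ∩ descendants par v).ncard ∧
        ((childSet r par v).Nonempty → (Z ∩ descendants par v).ncard ≠ 0) from
    H N v (Nat.le_add_left _ _)
  intro n
  induction n with
  | zero => exact fun v hv => absurd (hN v) (by omega)
  | succ n ih =>
    intro v hv
    rcases (childSet r par v).eq_empty_or_nonempty with hempty | hne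
    · rw [descendants_of_childSet_eq_empty hR.par_root hempty]
      exact ⟨layoutable_singleton v _, fun h => absurd hempty h.ne_empty⟩
    have ih' : ∀ u ∈ childSet r par v, _ := fun u hu =>
      ih u (by rw [hR.depth_of_mem_childSet hu]; omega)
    set f : V → ℕ := fun u => (Z ∩ descendants par u).ncard with hf
    set C : Finset V := Finset.univ.filter
      fun u => u ∈ childSet r par v ∧ (childSet r par u).Nonempty with hC
    set L : Finset V := Finset.univ.filter
      fun u => u ∈ childSet r par v ∧ childSet r par u = ∅ with hL
    have hCmem : ∀ u ∈ C, u ∈ childSet r par v := fun u hu => (Finset.mem_filter.1 hu).2.1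
    have hLmem : ∀ u ∈ L, u ∈ childSet r par v := fun u hu => (Finset.mem_filter.1 hu).2.1
    have hvd : ∀ u ∈ childSet r par v, Disjoint {v} (descendants par u) := fun u hu =>
      disjoint_singleton_left.2 (hR.notMem_descendants_of_mem_childSet hu)
    have hCL : descendants par v =
        {v} ∪ (⋃ u ∈ C, descendants par u) ∪ ⋃ u ∈ L, descendants par u := by
      rw [descendants_eq hR.par_root v, union_assoc]
      congr 1
      ext w
      simp only [mem_iUnion, mem_union, exists_prop, hC, hL, Finset.mem_filter,
        Finset.mem_univ, true_and]
      constructor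
      · rintro ⟨u, hu, hw⟩
        rcases (childSet r par u).eq_empty_or_nonempty with h | h
        · exact Or.inr ⟨u, ⟨hu, h⟩, hw⟩
        · exact Or.inl ⟨u, ⟨hu, h⟩, hw⟩
      · rintro (⟨u, hu, hw⟩ | ⟨u, hu, hw⟩)
        · exact ⟨u, hu.1, hw⟩
        · exact ⟨u, hu.1, hw⟩
    have hsum : ∑ u ∈ C, f u ≤ (Z ∩ descendants par v).ncard := by
      simp only [hf, ncard_eq_toFinset_card']
      rw [← Finset.card_biUnion]
      · refine Finset.card_le_card (Finset.biUnion_subset.2 fun u hu => ?_)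
        rw [toFinset_subset_toFinset]
        exact inter_subset_inter_right _ (descendants_subset_of_mem_childSet (hCmem u hu))
      · intro u hu w hw huw
        rw [Function.onFun, Set.disjoint_toFinset]
        exact (hR.disjoint_descendants (hCmem u hu) (hCmem w hw) huw).mono inter_subset_right
          inter_subset_right
    obtain ⟨m, hm0, hmle, hm⟩ : ∃ m ≠ 0, m ≤ (Z ∩ descendants par v).ncard ∧
        Layoutable T ({v} ∪ ⋃ u ∈ C, descendants par u) v m := by
      rcases C.eq_empty_or_nonempty with hCe | ⟨u, hu⟩
      · refine ⟨1, one_ne_zero, ?_, by simpa [hCe] using layoutable_singleton v 1⟩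
        refine (ncard_pos (toFinite _)).2 ⟨v, ⟨hne, fun u hu => ?_⟩, self_mem_descendants v⟩
        by_contra h
        have : u ∈ C :=
          Finset.mem_filter.2 ⟨Finset.mem_univ u, hu, nonempty_iff_ne_empty.2 h⟩
        simp [hCe] at this
      · have hfpos : ∀ u ∈ C, f u ≠ 0 := fun u hu =>
          (ih' u (hCmem u hu)).2 (Finset.mem_filter.1 hu).2.2
        refine ⟨∑ u ∈ C, f u, fun h => hfpos u hu (Finset.sum_eq_zero_iff.1 h u hu), hsum, ?_⟩
        have := hR.layoutable_union_descendants f (mem_singleton v) (layoutable_singleton v 0)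
          C hCmem (fun u hu => hvd u (hCmem u hu)) (fun u hu => by simpa using hfpos u hu)
          (fun u hu => (ih' u (hCmem u hu)).1)
        rwa [zero_add] at this
    refine ⟨?_, fun _ => by omega⟩
    have := hR.layoutable_union_descendants (fun _ => 0) (Or.inl (mem_singleton v)) hm L hLmem
      (fun u hu => ?_) (fun u _ => by simpa using hm0) (fun u hu => ?_)
    · rw [hCL]
      rw [hCL] at hmle
      exact Layoutable.mono (by simpa using this) hmle hm0
    · simp only [disjoint_union_left, disjoint_iUnion_left]
      refine ⟨hvd u (hLmem u hu), fun w hw => hR.disjoint_descendants (hCmem w hw) (hLmem u hu) ?_⟩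
      rintro rfl
      exact (Finset.mem_filter.1 hw).2.2.ne_empty (Finset.mem_filter.1 hu).2.2
    · rw [descendants_of_childSet_eq_empty hR.par_root (Finset.mem_filter.1 hu).2.2]
      exact layoutable_singleton u 0

end RootedLayout

section Counting

variable {V : Type} {T : SimpleGraph V} {r : V} {par : V → V} {depth : V → ℕ}

theorem IsRooting.neighborSet_eq (hR : IsRooting T r par depth) {v : V} (hv : v ≠ r) :
    T.neighborSet v = insert (par v) (childSet r par v) := by
  ext w
  simp [hR.adj_iff, childSet, hv, eq_comm (a := w)]

theorem IsRooting.par_notMem_childSet (hR : IsRooting T r par depth) {v : V} (hv : v ≠ r) :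
    par v ∉ childSet r par v := by
  intro h
  have h1 := hR.depth_of_mem_childSet h
  have h2 := hR.depth_eq v hv
  omega

theorem IsRooting.ncard_neighborSet_eq_one_iff [Finite V] (hR : IsRooting T r par depth) {v : V}
    (hv : v ≠ r) : (T.neighborSet v).ncard = 1 ↔ childSet r par v = ∅ := by
  rw [hR.neighborSet_eq hv, ncard_insert_of_notMem (hR.par_notMem_childSet hv),
    Nat.add_eq_right, ncard_eq_zero]

theorem IsRooting.mem_spineLeaves [Finite V] (hR : IsRooting T r par depth) {s w : V}
    (hr : T.neighborSet r = {s}) (hw : w ∈ lastBranchings r par) (hwr : w ≠ r) (hws : w ≠ s) :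
    w ∈ spineLeaves T := by
  have hpr : par w ≠ r := by
    intro h
    have : w ∈ T.neighborSet r := (hR.adj_iff r w).2 (Or.inr ⟨hwr, h⟩)
    rw [hr] at this
    exact hws this
  refine ⟨fun h => hw.1.ne_empty ((hR.ncard_neighborSet_eq_one_iff hwr).1 h),
    ncard_eq_one.2 ⟨par w, ?_⟩⟩
  ext u
  simp only [hR.neighborSet_eq hwr, mem_inter_iff, mem_insert_iff, mem_ofPred_eq,
    mem_singleton_iff]
  constructor
  · rintro ⟨rfl | hu, hdeg⟩
    · rfl
    · exact absurd ((hR.ncard_neighborSet_eq_one_iff hu.1).2 (hw.2 u hu)) hdeg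
  · rintro rfl
    refine ⟨Or.inl rfl, fun h => ?_⟩
    have hmem : w ∈ childSet r par (par w) := ⟨hwr, rfl⟩
    rw [(hR.ncard_neighborSet_eq_one_iff hpr).1 h] at hmem
    exact hmem

/-- A tree can be rooted so that it has fewer than `k` last branchings. -/
theorem exists_isRooting_ncard_lastBranchings_lt [Fintype V] (hT : T.IsTree)
    (h2 : 2 ≤ Fintype.card V) {k : ℕ} (hk : 3 ≤ k) (hleaves : (spineLeaves T).ncard ≤ k) :
    ∃ r par depth, IsRooting T r par depth ∧ (lastBranchings r par).ncard + 1 ≤ k := by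
  classical
  rcases (spineLeaves T).eq_empty_or_nonempty with hempty | ⟨s, hs1, hs2⟩
  · have : Nontrivial V := Fintype.one_lt_card_iff_nontrivial.1 h2
    obtain ⟨r, hr⟩ := hT.exists_vert_degree_one_of_nontrivial
    rw [← SimpleGraph.card_neighborSet_eq_degree, ← Nat.card_eq_fintype_card,
      Nat.card_coe_set_eq, ncard_eq_one] at hr
    obtain ⟨s, hs⟩ := hr
    obtain ⟨par, depth, hR⟩ := exists_isRooting hT r
    refine ⟨r, par, depth, hR, ?_⟩
    have hsub : lastBranchings r par ⊆ {r, s} := by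
      intro w hw
      by_contra hcon
      simp only [mem_insert_iff, mem_singleton_iff, not_or] at hcon
      have := hR.mem_spineLeaves hs hw hcon.1 hcon.2
      rw [hempty] at this
      exact this
    have h1 := ncard_le_ncard hsub
    have h2 := ncard_insert_le r {s}
    rw [ncard_singleton] at h2
    omega
  · obtain ⟨t, ht⟩ := ncard_eq_one.1 hs2
    have ht' : t ∈ T.neighborSet s ∩ {w | (T.neighborSet w).ncard ≠ 1} := ht ▸ mem_singleton t
    obtain ⟨r, hrs, hrt⟩ : ∃ r ∈ T.neighborSet s, r ≠ t := by
      by_contra! hcon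
      exact hs1 (ncard_eq_one.2 ⟨t, (subset_singleton_iff.2 hcon).antisymm
        (singleton_subset_iff.2 ht'.1)⟩)
    have hr1 : (T.neighborSet r).ncard = 1 := by
      by_contra hcon
      have : r ∈ T.neighborSet s ∩ {w | (T.neighborSet w).ncard ≠ 1} := ⟨hrs, hcon⟩
      rw [ht] at this
      exact hrt this
    have hr : T.neighborSet r = {s} := by
      obtain ⟨s', hs'⟩ := ncard_eq_one.1 hr1
      have : s ∈ T.neighborSet r := SimpleGraph.Adj.symm hrs
      rw [hs'] at this ⊢
      rw [mem_singleton_iff.1 this]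
    obtain ⟨par, depth, hR⟩ := exists_isRooting hT r
    have hsr : s ≠ r := T.ne_of_adj hrs
    have hsc : s ∈ childSet r par r := by
      rcases (hR.adj_iff s r).1 hrs with h | h
      · exact h
      · exact absurd rfl h.1
    have htc : t ∈ childSet r par s := by
      rcases (hR.adj_iff s t).1 ht'.1 with h | h
      · exact absurd (hsc.2.symm.trans h.2) hrt
      · exact h
    have htne : childSet r par t ≠ ∅ := fun h =>
      ht'.2 ((hR.ncard_neighborSet_eq_one_iff htc.1).2 h)
    refine ⟨r, par, depth, hR, le_trans ?_ hleaves⟩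
    have hsub : lastBranchings r par ⊆ spineLeaves T \ {s} := by
      intro w hw
      have hws : w ≠ s := by
        rintro rfl
        exact htne (hw.2 t htc)
      refine ⟨hR.mem_spineLeaves hr hw ?_ hws, hws⟩
      rintro rfl
      have := hw.2 s hsc
      rw [this] at htc
      exact htc
    have h1 := ncard_le_ncard hsub
    rw [ncard_sdiff_singleton_of_mem (show s ∈ spineLeaves T from ⟨hs1, hs2⟩)] at h1
    have h3 : 0 < (spineLeaves T).ncard := (ncard_pos (toFinite _)).2 ⟨s, hs1, hs2⟩
    omega

end Counting

/-- A tree drawn with noncrossing chords of `K` is the graph of an outer folding. -/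
theorem exists_iso_outerGraph {V : Type} [Fintype V] {T : SimpleGraph V} {K : Set ℂ}
    (hKc : IsCompact K) (hK : Convex ℝ K) (hne : (interior K).Nonempty)
    (hdeg : ∀ v, ∃ w, T.Adj v w) {b : ℝ → ℂ} (hb : IsBoundaryParam K b) {θ : ℝ}
    (hθ : b θ ∈ K.extremePoints ℝ) {Θ : Finset ℝ}
    (hΘ : ∀ t ∈ Θ, b t ∈ K.extremePoints ℝ) {x : V → ℝ} (hx : IsLayout T univ Θ x)
    (hxθ : ∀ v, x v ∈ Ioo θ (θ + 2 * Real.pi)) :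
    ∃ φ : ℂ → ℂ, IsOuterLocalFlatFolding K φ ∧ Nonempty (T ≃g outerGraph K φ) := by
  classical
  have hxinj : Function.Injective x := injOn_univ.1 hx.injOn
  have hpos : Function.Injective fun v => b (x v) := by
    intro v w h
    refine hxinj (hb.eq_of_eq _ _ (abs_sub_lt_iff.2 ⟨?_, ?_⟩) h) <;>
      linarith [(hxθ v).1, (hxθ v).2, (hxθ w).1, (hxθ w).2]
  have hchord : ∀ c d, T.Adj c d → x c < x d → IsChord K (b (x c)) (b (x d)) := by
    intro c d hcd hlt
    obtain ⟨t, ht, h1, h2⟩ := hx.exists_between c (mem_univ c) d (mem_univ d) hcd hlt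
    exact hb.isChord hKc.isClosed hK h1 h2 (hxθ d).2 (by linarith [(hxθ c).1]) (hΘ t ht)
      (by rwa [hb.periodic])
  set E : Finset (V × V) := Finset.univ.filter fun e => T.Adj e.1 e.2 ∧ x e.1 < x e.2 with hE
  set S : Finset (ℂ × ℂ) := E.image fun e => (b (x e.1), b (x e.2)) with hS
  have hSmem : ∀ c ∈ S, ∃ v w, T.Adj v w ∧ x v < x w ∧ c = (b (x v), b (x w)) := by
    intro c hc
    obtain ⟨e, he, rfl⟩ := Finset.mem_image.1 hc
    rw [hE, Finset.mem_filter] at he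
    exact ⟨e.1, e.2, he.2.1, he.2.2, rfl⟩
  have hmemS : ∀ v w, T.Adj v w → x v < x w → (b (x v), b (x w)) ∈ S := fun v w h h' =>
    Finset.mem_image.2 ⟨(v, w), Finset.mem_filter.2 ⟨Finset.mem_univ _, h, h'⟩, rfl⟩
  obtain ⟨φ, hφ, hcr⟩ := exists_isOuterLocalFlatFolding hKc hK hne S
    (by
      intro c hc
      obtain ⟨v, w, h, h', rfl⟩ := hSmem c hc
      exact hchord v w h h')
    (by
      intro c hc c' hc' hcc
      obtain ⟨v, w, h, h', rfl⟩ := hSmem c hc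
      obtain ⟨v', w', h1, h1', rfl⟩ := hSmem c' hc'
      refine hb.disjoint_of_not_interlace hKc.isClosed hK (hxθ v) (hxθ w) (hxθ v') (hxθ w') h' h1'
        (hchord v w h h') ?_ ?_ ?_
      · rintro ⟨e1, e2⟩
        exact hcc (by rw [e1, e2])
      · exact hx.noncrossing v (mem_univ _) w (mem_univ _) v' (mem_univ _) w' (mem_univ _) h h1
      · exact hx.noncrossing v' (mem_univ _) w' (mem_univ _) v (mem_univ _) w (mem_univ _) h1 h)
  have hcrease : ∀ p q, IsCreaseOf K φ p q ↔ ∃ v w, T.Adj v w ∧ b (x v) = p ∧ b (x w) = q := by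
    intro p q
    rw [hcr]
    constructor
    · rintro (h | h)
      · obtain ⟨v, w, h, -, he⟩ := hSmem _ h
        exact ⟨v, w, h, (congrArg Prod.fst he).symm, (congrArg Prod.snd he).symm⟩
      · obtain ⟨v, w, h, -, he⟩ := hSmem _ h
        exact ⟨w, v, h.symm, (congrArg Prod.snd he).symm, (congrArg Prod.fst he).symm⟩
    · rintro ⟨v, w, h, rfl, rfl⟩
      rcases lt_or_gt_of_ne (hxinj.ne h.ne) with h' | h'
      · exact Or.inl (hmemS v w h h')
      · exact Or.inr (hmemS w v h.symm h')
  refine ⟨φ, hφ, ⟨⟨Equiv.ofBijective (fun v => (⟨b (x v), by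
    obtain ⟨w, hw⟩ := hdeg v
    exact ⟨b (x w), (hcrease _ _).2 ⟨v, w, hw, rfl, rfl⟩⟩⟩ : OuterVertex K φ)) ⟨?_, ?_⟩, ?_⟩⟩⟩
  · intro v w h
    exact hpos (congrArg Subtype.val h)
  · rintro ⟨p, q, hpq⟩
    obtain ⟨v, w, -, rfl, -⟩ := (hcrease p q).1 hpq
    exact ⟨v, rfl⟩
  · intro v w
    simp only [outerGraph, SimpleGraph.fromRel_adj, hcrease]
    constructor
    · rintro ⟨-, ⟨v', w', h, h1, h2⟩ | ⟨v', w', h, h1, h2⟩⟩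
      · rwa [← hpos h1, ← hpos h2]
      · rw [← hpos h1, ← hpos h2]
        exact h.symm
    · intro h
      exact ⟨fun he => h.ne (hpos (congrArg Subtype.val he)), Or.inl ⟨v, w, h, rfl, rfl⟩⟩

theorem stmt18_spine_fold (V : Type) [Fintype V] (T : SimpleGraph V) (hT : T.IsTree)
    (h3 : 3 ≤ Fintype.card V) (k : ℕ) (K : Set ℂ) (hK : IsConvexPolygon K k)
    (hleaves : (spineLeaves T).ncard ≤ k) :
    ∃ φ : ℂ → ℂ, IsOuterLocalFlatFolding K φ ∧ Nonempty (T ≃g outerGraph K φ) := by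
  classical
  obtain ⟨hk, P, rfl, hP⟩ := hK
  have hKc : IsCompact (convexHull ℝ (range P)) := (finite_range P).isCompact_convexHull ℝ
  have hKconv := convex_convexHull ℝ (range P)
  have hne := interior_convexHull_nonempty_of_notMem hk hP
  have hext := mem_extremePoints_of_notMem_convexHull hP
  have hPinj := injective_of_notMem_convexHull hP
  obtain ⟨b, hb⟩ := exists_isBoundaryParam hKc hKconv hne
  have hfr : ∀ i, P i ∈ frontier (convexHull ℝ (range P)) := fun i =>
    mem_frontier_of_mem_extremePoints (hext i)
  let i₀ : Fin k := ⟨0, by omega⟩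
  obtain ⟨θ, -, hθ⟩ := hb.exists_eq (P i₀) (hfr i₀) 0
  choose t ht htP using fun i => hb.exists_eq (P i) (hfr i) θ
  have htinj : Function.Injective t := fun i j h => hPinj (by rw [← htP i, ← htP j, h])
  obtain ⟨r, par, depth, hR, hcard⟩ :=
    exists_isRooting_ncard_lastBranchings_lt hT (by omega) hk hleaves
  have hlay := (hR.layoutable_descendants r).1
  rw [hR.descendants_root, inter_univ] at hlay
  obtain ⟨x, hx, hxθ, -, -⟩ := hlay θ (θ + 2 * Real.pi) (by linarith [Real.pi_pos])
    ((Finset.univ.erase i₀).image t)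
    (by
      intro s hs
      obtain ⟨i, hi, rfl⟩ := Finset.mem_image.1 hs
      refine ⟨lt_of_le_of_ne (ht i).1 fun h => Finset.ne_of_mem_erase hi (hPinj ?_), (ht i).2⟩
      rw [← htP i, ← hθ, h])
    (by
      rw [Finset.card_image_of_injective _ htinj, Finset.card_erase_of_mem (Finset.mem_univ _),
        Finset.card_univ, Fintype.card_fin]
      omega)
  have : Nontrivial V := Fintype.one_lt_card_iff_nontrivial.1 (by omega)
  refine exists_iso_outerGraph hKc hKconv hne (fun v => ?_) hb (hθ ▸ hext i₀) ?_ hx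
    fun v => hxθ (mem_univ v)
  · exact hT.connected.preconnected.exists_adj_of_nontrivial v
  · intro s hs
    obtain ⟨i, -, rfl⟩ := Finset.mem_image.1 hs
    exact htP i ▸ hext i
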